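/- For every nonnegative integer s, there exists an integer j with s+3 ≤ j ≤ 2s+3 such that the 2-adic Hurwitz zeta value ζ₂(j,1/4) is irrational, i.e. does not lie in the image of ℚ in ℚ₂. -/

import Mathlib

open Filter Finset

/-- `zeta2Quarter j z` says that `z` is the 2-adic Hurwitz zeta value `ζ₂(j, 1/4)`,
i.e. `(j-1) * 4^(j-1) * z` is the 2-adic limit of the Volkenborn sums
`2^{-M} ∑_{k=0}^{2^M-1} (k+1/4)^{1-j}`. -/
def zeta2Quarter (j : ℕ) (z : ℚ_[2]) : Prop :=
  Filter.Tendsto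
    (fun M : ℕ => (2 ^ M : ℚ_[2])⁻¹ *
      ∑ k ∈ Finset.range (2 ^ M), ((((k : ℚ) + 1/4) ^ ((1 : ℤ) - (j : ℤ)) : ℚ) : ℚ_[2]))
    Filter.atTop (nhds (((j : ℚ_[2]) - 1) * 4 ^ (j - 1) * z))

namespace Z2
section PartP
open Topology

local notation "Lam" => ArithmeticFunction.vonMangoldt

lemma tend_L (τ : ℝ) : Tendsto (fun σ : ℝ => ((σ:ℂ) - 1) *
    LSeries (fun n => ((Lam n : ℝ) : ℂ)) ((σ:ℂ) - Complex.I * τ)) (𝓝[>] 1)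
    (𝓝 (if τ = 0 then 1 else 0)) := by
  have hc := ArithmeticFunction.vonMangoldt.continuousOn_LFunctionResidueClassAux (1 : ZMod 1)
  have he := ArithmeticFunction.vonMangoldt.eqOn_LFunctionResidueClassAux (a := (1 : ZMod 1)) isUnit_one
  set F := ArithmeticFunction.vonMangoldt.LFunctionResidueClassAux (1 : ZMod 1) with hF
  have hres : (fun n : ℕ => ((ArithmeticFunction.vonMangoldt.residueClass (1 : ZMod 1) n : ℝ) : ℂ))
      = fun n => ((Lam n : ℝ) : ℂ) := by
    funext n
    congr 1
    unfold ArithmeticFunction.vonMangoldt.residueClass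
    rw [Set.indicator_of_mem]
    exact Subsingleton.elim _ _
  have h1 : Tendsto (fun σ : ℝ => ((σ:ℂ) - 1)) (𝓝[>] 1) (𝓝 0) := by
    have : Continuous (fun σ : ℝ => ((σ:ℂ) - 1)) := by fun_prop
    have := this.tendsto 1
    simp only [Complex.ofReal_one, sub_self] at this
    exact this.mono_left nhdsWithin_le_nhds
  have h2 : Tendsto (fun σ : ℝ => ((σ:ℂ) - Complex.I * τ)) (𝓝[>] 1) (𝓝[{s | 1 ≤ s.re}] (1 - Complex.I * τ)) := by
    apply tendsto_nhdsWithin_of_tendsto_nhds_of_eventually_within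
    · have : Continuous (fun σ : ℝ => ((σ:ℂ) - Complex.I * τ)) := by fun_prop
      have := this.tendsto 1
      simp only [Complex.ofReal_one] at this
      exact this.mono_left nhdsWithin_le_nhds
    · filter_upwards [self_mem_nhdsWithin] with σ hσ
      simpa using le_of_lt hσ
  have h3 : Tendsto (fun σ : ℝ => F ((σ:ℂ) - Complex.I * τ)) (𝓝[>] 1) (𝓝 (F (1 - Complex.I * τ))) :=
    (hc (1 - Complex.I * τ) (by simp)).tendsto.comp h2
  have h4 : Tendsto (fun σ : ℝ => ((σ:ℂ) - 1) / ((σ:ℂ) - Complex.I * τ - 1)) (𝓝[>] 1)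
    (𝓝 (if τ = 0 then 1 else 0)) := by
    split_ifs with h
    · subst h
      refine tendsto_const_nhds.congr' ?_
      filter_upwards [self_mem_nhdsWithin] with σ hσ
      have : (σ:ℂ) - 1 ≠ 0 := by
        rw [sub_ne_zero]; exact_mod_cast ne_of_gt hσ
      simp [div_self this]
    · have : Tendsto (fun σ : ℝ => ((σ:ℂ) - Complex.I * τ - 1)) (𝓝[>] 1) (𝓝 (1 - Complex.I * τ - 1)) := by
        exact ((tendsto_nhdsWithin_iff.1 h2).1).sub_const 1
      have := h1.div this (by simpa using h)
      rw [zero_div] at this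
      exact this
  have h5 := (h1.mul h3).add h4
  simp only [zero_mul, zero_add] at h5
  refine h5.congr' ?_
  filter_upwards [self_mem_nhdsWithin] with σ hσ
  have := he (x := (σ:ℂ) - Complex.I * τ) (by simpa using hσ)
  rw [this]
  simp only [hres]
  simp
  ring

lemma summ_L {σ : ℝ} (hσ : 1 < σ) : Summable (fun n : ℕ => Lam n * (n:ℝ) ^ (-σ)) := by
  have := ArithmeticFunction.LSeriesSummable_vonMangoldt (s := (σ:ℂ)) (by simpa using hσ)
  have := this.norm
  refine this.congr fun n => ?_
  rw [LSeries.term_def]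
  split_ifs with h
  · simp [h]
  · have hn : (0:ℝ) < n := by positivity
    rw [norm_div, Complex.norm_natCast_cpow_of_pos (by omega), Real.rpow_neg hn.le]
    simp [abs_of_nonneg ArithmeticFunction.vonMangoldt_nonneg, div_eq_mul_inv]

lemma summ_g {σ : ℝ} (hσ : 1 < σ) (g : C(AddCircle (1:ℝ), ℂ)) :
    Summable (fun n : ℕ => ((Lam n * (n:ℝ) ^ (-σ) : ℝ) : ℂ) * g ((Real.logb 2 n : ℝ) : AddCircle (1:ℝ))) := by
  refine Summable.of_norm_bounded ((summ_L hσ).mul_right ‖g‖) fun n => ?_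
  rw [norm_mul]
  have : 0 ≤ Lam n * (n:ℝ) ^ (-σ) := mul_nonneg ArithmeticFunction.vonMangoldt_nonneg (by positivity)
  rw [Complex.norm_real, Real.norm_of_nonneg this]
  gcongr
  exact g.norm_coe_le_norm _

lemma tend_fourier (k : ℤ) : Tendsto (fun σ : ℝ => ((σ:ℂ) - 1) *
    ∑' n : ℕ, ((Lam n * (n:ℝ) ^ (-σ) : ℝ) : ℂ) * fourier k ((Real.logb 2 n : ℝ) : AddCircle (1:ℝ)))
    (𝓝[>] 1) (𝓝 (fourierCoeff (fourier k : AddCircle (1:ℝ) → ℂ) 0)) := by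
  have h := tend_L (2 * Real.pi * k / Real.log 2)
  have hl : Real.log 2 ≠ 0 := (Real.log_pos (by norm_num)).ne'
  rw [fourierCoeff_fourier]
  have : (if (2 * Real.pi * k / Real.log 2) = 0 then (1:ℂ) else 0) = (Pi.single k (1:ℂ) : ℤ → ℂ) 0 := by
    rw [Pi.single_apply]
    refine if_congr ?_ rfl rfl
    rw [eq_comm (a := (0:ℤ))]
    simp [hl, Real.pi_ne_zero]
  rw [← this]
  refine h.congr fun σ => ?_
  congr 1
  unfold LSeries
  refine tsum_congr fun n => ?_
  rw [LSeries.term_def]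
  split_ifs with hn
  · simp [hn]
  · rw [fourier_coe_apply]
    have hn' : (n:ℂ) ≠ 0 := by exact_mod_cast hn
    have hnr : (0:ℝ) < n := by positivity
    push_cast
    rw [mul_assoc ((Lam n : ℝ) : ℂ), div_eq_mul_inv ((Lam n : ℝ) : ℂ)]
    congr 1
    rw [Complex.ofReal_cpow hnr.le, Complex.ofReal_natCast, Complex.cpow_def_of_ne_zero hn', Complex.cpow_def_of_ne_zero hn', ← Complex.exp_neg, ← Complex.exp_add]
    congr 1
    rw [Real.logb]
    push_cast
    have : (Real.log 2 : ℂ) ≠ 0 := by exact_mod_cast hl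
    field_simp
    ring

lemma tend_span (g : C(AddCircle (1:ℝ), ℂ)) (hg : g ∈ Submodule.span ℂ (Set.range (@fourier (1:ℝ)))) :
    Tendsto (fun σ : ℝ => ((σ:ℂ) - 1) *
    ∑' n : ℕ, ((Lam n * (n:ℝ) ^ (-σ) : ℝ) : ℂ) * g ((Real.logb 2 n : ℝ) : AddCircle (1:ℝ)))
    (𝓝[>] 1) (𝓝 (fourierCoeff (g : AddCircle (1:ℝ) → ℂ) 0)) := by
  induction hg using Submodule.span_induction with
  | mem x h => obtain ⟨k, rfl⟩ := h; exact tend_fourier k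
  | zero => simp [fourierCoeff]
  | add x y _ _ hx hy =>
    have e : fourierCoeff (⇑(x + y)) 0 = fourierCoeff (⇑x) 0 + fourierCoeff (⇑y) 0 := by
      have := congrFun (fourierCoeff.add (f := x) (g := y) (x.continuous.integrable_of_hasCompactSupport (HasCompactSupport.of_compactSpace _)) (y.continuous.integrable_of_hasCompactSupport (HasCompactSupport.of_compactSpace _))) 0
      simpa using this
    rw [e]
    refine (hx.add hy).congr' ?_
    filter_upwards [self_mem_nhdsWithin] with σ hσ
    rw [← mul_add, ← (summ_g hσ x).tsum_add (summ_g hσ y)]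
    congr 1
    exact tsum_congr fun n => by simp [mul_add]
  | smul c x _ hx =>
    have e : fourierCoeff (⇑(c • x)) 0 = c * fourierCoeff (⇑x) 0 := by
      have := fourierCoeff.const_smul (⇑x) c 0
      simpa using this
    rw [e]
    refine (hx.const_mul c).congr fun σ => ?_
    rw [mul_left_comm, ← tsum_mul_left]
    congr 1
    exact tsum_congr fun n => by simp [mul_left_comm]


noncomputable def wfun (u : ℝ) : ℝ := 2 ^ (u - 1) + (1 - u) ^ 49 / 2

lemma wfun_cont : Continuous wfun := by
  unfold wfun
  have : Continuous (fun u : ℝ => (2:ℝ) ^ (u - 1)) := by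
    refine Continuous.rpow continuous_const (by fun_prop) (fun x => Or.inl (by norm_num))
  fun_prop

noncomputable def Wc : C(AddCircle (1:ℝ), ℂ) :=
  ⟨AddCircle.liftIco 1 0 (fun u => (wfun u : ℂ)), by
    apply AddCircle.liftIco_continuous
    · norm_num [wfun, Real.rpow_neg_one]
    · have := wfun_cont
      fun_prop⟩

lemma Wc_apply (x : ℝ) (hx0 : 0 ≤ x) (hx1 : x < 1) : Wc (x : AddCircle (1:ℝ)) = (wfun x : ℂ) := by
  change AddCircle.liftIco (1:ℝ) 0 (fun u => (wfun u : ℂ)) _ = _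
  exact AddCircle.liftIco_coe_apply ⟨hx0, by simpa using hx1⟩

lemma Wc_bound (n c : ℕ) (hn : 0 < n) (hc : n ≤ 2 ^ c) :
    (n:ℝ) / 2 ^ c ≤ (Wc ((Real.logb 2 n : ℝ) : AddCircle (1:ℝ))).re := by
  obtain ⟨m, hm1, hm2⟩ : ∃ m : ℕ, 2 ^ m ≤ n ∧ n < 2 ^ (m + 1) :=
    ⟨Nat.log 2 n, Nat.pow_log_le_self 2 hn.ne', Nat.lt_pow_succ_log_self (by norm_num) n⟩
  have hnr : (0:ℝ) < n := by positivity
  have hm1' : (2:ℝ) ^ m ≤ n := by exact_mod_cast hm1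
  have hm2' : (n:ℝ) < 2 ^ (m + 1) := by exact_mod_cast hm2
  have hc' : (n:ℝ) ≤ 2 ^ c := by exact_mod_cast hc
  set y := Real.logb 2 n - m with hy
  have hy0 : 0 ≤ y := by
    rw [hy, sub_nonneg, Real.le_logb_iff_rpow_le (by norm_num) hnr]
    simpa using hm1'
  have hy1 : y < 1 := by
    rw [hy, sub_lt_iff_lt_add, Real.logb_lt_iff_lt_rpow (by norm_num) hnr, add_comm]
    exact_mod_cast hm2'
  have hcoe : ((Real.logb 2 n : ℝ) : AddCircle (1:ℝ)) = (y : AddCircle (1:ℝ)) := by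
    rw [hy, AddCircle.coe_sub, (AddCircle.coe_eq_zero_iff (x := (m:ℝ)) 1).2 ⟨m, by simp⟩, sub_zero]
  rw [hcoe, Wc_apply y hy0 hy1, Complex.ofReal_re]
  have e1 : (2:ℝ) ^ (y - 1) = n / 2 ^ (m + 1) := by
    rw [hy, Real.rpow_sub (by norm_num), Real.rpow_sub (by norm_num), Real.rpow_logb (by norm_num) (by norm_num) hnr]
    simp [pow_succ, div_div]
  unfold wfun
  rw [e1]
  rcases hm1.eq_or_lt with h | h
  · have hn2 : (n:ℝ) = 2 ^ m := by rw [← h]; simp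
    have : y = 0 := by
      rw [hy, hn2, ← Real.rpow_natCast, Real.logb_rpow (by norm_num) (by norm_num), sub_self]
    rw [this, hn2, pow_succ]
    have : (2:ℝ)^m / 2 ^ c ≤ 1 := by rw [div_le_one (by positivity), ← hn2]; exact hc'
    have h2 : (2:ℝ)^m / (2^m * 2) = 1/2 := by field_simp
    rw [h2]; norm_num; linarith
  · have : m + 1 ≤ c := by
      have : 2 ^ m < 2 ^ c := by omega
      have := (Nat.pow_lt_pow_iff_right (by norm_num : 1 < 2)).1 this
      omega
    have h1 : (n:ℝ) / 2 ^ c ≤ n / 2 ^ (m+1) := by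
      gcongr
      norm_num
    have h2 : 0 ≤ (1 - y) ^ 49 / 2 := by
      have : 0 ≤ 1 - y := by linarith
      positivity
    exact h1.trans (le_add_of_nonneg_right h2)

lemma inner_bound {σ : ℝ} (hσ : 1 < σ) (n R : ℕ) (hn : 0 < n) :
    ∑ r ∈ (range R).filter (fun r => n ≤ 2 ^ r), (2:ℝ) ^ (-(r * σ)) ≤
      2 * ((n:ℝ) ^ (-σ) * (Wc ((Real.logb 2 n : ℝ) : AddCircle (1:ℝ))).re) := by
  set W := (Wc ((Real.logb 2 n : ℝ) : AddCircle (1:ℝ))).re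
  have hnr : (0:ℝ) < n := by positivity
  set c := Nat.clog 2 n with hc
  have hcn : n ≤ 2 ^ c := Nat.le_pow_clog (by norm_num) n
  have hW : (n:ℝ) / 2 ^ c ≤ W := Wc_bound n c hn hcn
  have hW0 : 0 ≤ W := le_trans (by positivity) hW
  have hterm : ∀ r ∈ Ico c (max R c), (2:ℝ) ^ (-(r * σ)) ≤ (n:ℝ) ^ (-σ) * W * (1/2) ^ (r - c) := by
    intro r hr
    rw [Finset.mem_Ico] at hr
    have h2r : (n:ℝ) ≤ 2 ^ r := by
      have : n ≤ 2 ^ r := hcn.trans (Nat.pow_le_pow_right (by norm_num) hr.1)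
      exact_mod_cast this
    have e : (2:ℝ) ^ (-(r * σ)) = (n:ℝ) ^ (-σ) * ((n:ℝ) / 2 ^ r) ^ σ := by
      rw [Real.div_rpow hnr.le (by positivity), ← Real.rpow_natCast 2 r, ← Real.rpow_mul (by norm_num),
        Real.rpow_neg (by norm_num), Real.rpow_neg hnr.le]
      have : (n:ℝ) ^ σ ≠ 0 := by positivity
      field_simp
    rw [e, mul_assoc]
    gcongr
    calc ((n:ℝ) / 2 ^ r) ^ σ ≤ ((n:ℝ) / 2 ^ r) ^ (1:ℝ) := by
          apply Real.rpow_le_rpow_of_exponent_ge (by positivity) _ hσ.le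
          rw [div_le_one (by positivity)]; exact h2r
      _ = ((n:ℝ) / 2 ^ c) * (1/2) ^ (r - c) := by
          rw [Real.rpow_one]
          have : (2:ℝ) ^ r = 2 ^ c * 2 ^ (r - c) := by rw [← pow_add]; congr 1; omega
          rw [this]; field_simp; rw [div_pow]; field_simp; simp
      _ ≤ _ := by gcongr
  calc ∑ r ∈ (range R).filter (fun r => n ≤ 2 ^ r), (2:ℝ) ^ (-(r * σ))
      ≤ ∑ r ∈ Ico c (max R c), (2:ℝ) ^ (-(r * σ)) := by
        apply Finset.sum_le_sum_of_subset_of_nonneg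
        · intro r hr
          simp only [Finset.mem_filter, Finset.mem_range, Finset.mem_Ico] at hr ⊢
          exact ⟨Nat.clog_le_of_le_pow hr.2, lt_max_of_lt_left hr.1⟩
        · intros; positivity
    _ ≤ ∑ r ∈ Ico c (max R c), (n:ℝ) ^ (-σ) * W * (1/2) ^ (r - c) := Finset.sum_le_sum hterm
    _ = (n:ℝ) ^ (-σ) * W * ∑ i ∈ range (max R c - c), (1/2:ℝ) ^ i := by
        rw [← Finset.mul_sum, Finset.sum_Ico_eq_sum_range]
        simp
    _ ≤ (n:ℝ) ^ (-σ) * W * 2 := by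
        gcongr
        exact sum_geometric_two_le _
    _ = _ := by ring

lemma Wc_nonneg (n : ℕ) (hn : 0 < n) : 0 ≤ (Wc ((Real.logb 2 n : ℝ) : AddCircle (1:ℝ))).re :=
  le_trans (by positivity) (Wc_bound n (Nat.clog 2 n) hn (Nat.le_pow_clog (by norm_num) n))

lemma summ_W {σ : ℝ} (hσ : 1 < σ) :
    Summable (fun n : ℕ => Lam n * (n:ℝ) ^ (-σ) * (Wc ((Real.logb 2 n : ℝ) : AddCircle (1:ℝ))).re) := by
  have := Complex.reCLM.summable (summ_g hσ Wc)
  refine this.congr fun n => ?_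
  simp only [Complex.reCLM_apply, Complex.re_ofReal_mul]

lemma psi_sum_bound {σ : ℝ} (hσ : 1 < σ) (R : ℕ) :
    ∑ r ∈ range R, Chebyshev.psi (2 ^ r) * (2:ℝ) ^ (-(r * σ)) ≤
      2 * ∑' n : ℕ, Lam n * (n:ℝ) ^ (-σ) * (Wc ((Real.logb 2 n : ℝ) : AddCircle (1:ℝ))).re := by
  have hpsi : ∀ r ∈ range R, Chebyshev.psi (2 ^ r) * (2:ℝ) ^ (-(r * σ)) =
      ∑ n ∈ range (2 ^ R + 1), if n ≤ 2 ^ r then Lam n * (2:ℝ) ^ (-(r * σ)) else 0 := by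
    intro r hr
    rw [Chebyshev.psi_eq_sum_Icc, Finset.sum_mul, ← Finset.sum_filter]
    apply Finset.sum_congr _ (fun _ _ => rfl)
    have hf : ⌊(2:ℝ) ^ r⌋₊ = 2 ^ r := by exact_mod_cast Nat.floor_natCast (R := ℝ) (2 ^ r)
    rw [hf]
    ext n
    simp only [Finset.mem_Icc, Finset.mem_filter, Finset.mem_range]
    have : 2 ^ r ≤ 2 ^ R := Nat.pow_le_pow_right (by norm_num) (Finset.mem_range.1 hr).le
    omega
  rw [Finset.sum_congr rfl hpsi, Finset.sum_comm]
  calc _ ≤ ∑ n ∈ range (2 ^ R + 1), 2 * (Lam n * (n:ℝ) ^ (-σ) * (Wc ((Real.logb 2 n : ℝ) : AddCircle (1:ℝ))).re) := by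
        apply Finset.sum_le_sum
        intro n _
        rcases Nat.eq_zero_or_pos n with rfl | hn
        · simp
        · rw [← Finset.sum_filter, ← Finset.mul_sum]
          have := mul_le_mul_of_nonneg_left (inner_bound hσ n R hn) (ArithmeticFunction.vonMangoldt_nonneg (n := n))
          linarith
    _ ≤ _ := by
        rw [← Finset.mul_sum]
        gcongr
        apply (summ_W hσ).sum_le_tsum
        intro n _
        rcases Nat.eq_zero_or_pos n with rfl | hn
        · simp
        · exact mul_nonneg (mul_nonneg ArithmeticFunction.vonMangoldt_nonneg (by positivity)) (Wc_nonneg n hn)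

lemma wfun_integral : ∫ u in (0:ℝ)..1, wfun u ≤ 0.732 := by
  have hl : 0 < Real.log 2 := Real.log_pos (by norm_num)
  have h1 : ∫ u in (0:ℝ)..1, wfun u = (2 ^ (1 - 1 : ℝ) / Real.log 2 - (1 - 1) ^ 50 / 100) - (2 ^ (0 - 1 : ℝ) / Real.log 2 - (1 - 0) ^ 50 / 100) := by
    apply intervalIntegral.integral_eq_sub_of_hasDerivAt (f := fun u : ℝ => (2:ℝ) ^ (u - 1) / Real.log 2 - (1 - u) ^ 50 / 100)
    · intro x _
      have a1 : HasDerivAt (fun u : ℝ => u - 1) 1 x := (hasDerivAt_id x).sub_const 1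
      have a2 := (a1.const_rpow (a := 2) (by norm_num)).div_const (Real.log 2)
      have b1 : HasDerivAt (fun u : ℝ => 1 - u) (-1) x := (hasDerivAt_id x).const_sub 1
      have b2 := (b1.pow 50).div_const 100
      refine HasDerivAt.congr_deriv (a2.sub b2) ?_
      unfold wfun
      norm_num
      field_simp
      have : (50:ℝ) * (1 - x)^49 = 50 * (1-x)^49 := rfl
      generalize (1-x)^49 = z
      ring
    · exact wfun_cont.intervalIntegrable _ _
  rw [h1]
  have : (2:ℝ) ^ (0 - 1 : ℝ) = 1/2 := by rw [zero_sub, Real.rpow_neg_one]; norm_num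
  rw [this]
  have h2 := Real.log_two_gt_d9
  have h3 : 1 / Real.log 2 ≤ 1.443 := by
    rw [div_le_iff₀ hl]; nlinarith
  norm_num
  rw [one_div] at h3
  have : 1 / 2 / Real.log 2 = (1/2) * (Real.log 2)⁻¹ := by rw [div_eq_mul_inv]
  norm_num at *
  linarith

lemma fc_norm_le (g : C(AddCircle (1:ℝ), ℂ)) : ‖fourierCoeff (g : AddCircle (1:ℝ) → ℂ) 0‖ ≤ ‖g‖ := by
  unfold fourierCoeff
  simp only [neg_zero, fourier_zero, one_smul]
  have := MeasureTheory.norm_integral_le_of_norm_le_const (μ := AddCircle.haarAddCircle) (f := (g : AddCircle (1:ℝ) → ℂ)) (C := ‖g‖)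
    (Filter.Eventually.of_forall fun x => g.norm_coe_le_norm x)
  simpa using this

lemma fc_W : fourierCoeff (Wc : AddCircle (1:ℝ) → ℂ) 0 = ((∫ u in (0:ℝ)..1, wfun u : ℝ) : ℂ) := by
  change fourierCoeff (AddCircle.liftIco (1:ℝ) 0 (fun u => (wfun u : ℂ))) 0 = _
  rw [fourierCoeff_liftIco_eq, fourierCoeffOn_eq_integral]
  simp [intervalIntegral.integral_ofReal]

lemma fc_sub (x y : C(AddCircle (1:ℝ), ℂ)) : fourierCoeff (⇑(x - y)) 0 = fourierCoeff (⇑x) 0 - fourierCoeff (⇑y) 0 := by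
  have hx := (x.continuous.integrable_of_hasCompactSupport (μ := AddCircle.haarAddCircle) (HasCompactSupport.of_compactSpace _))
  have hy := (y.continuous.integrable_of_hasCompactSupport (μ := AddCircle.haarAddCircle) (HasCompactSupport.of_compactSpace _))
  unfold fourierCoeff
  simp only [neg_zero, fourier_zero, one_smul]
  rw [← MeasureTheory.integral_sub hx hy]
  rfl

theorem psi_small (r0 : ℕ) : ∃ r ≥ r0, Chebyshev.psi (2 ^ r) < 1.5 * Real.log 2 * 2 ^ r := by
  by_contra! hcon
  have hl : 0 < Real.log 2 := Real.log_pos (by norm_num)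
  obtain ⟨p, hp, hpW⟩ : ∃ p ∈ Submodule.span ℂ (Set.range (@fourier (1:ℝ))), ‖Wc - p‖ < 0.005 := by
    have h := span_fourier_closure_eq_top (T := (1:ℝ))
    have hW : Wc ∈ (Submodule.span ℂ (Set.range (@fourier (1:ℝ)))).topologicalClosure := by rw [h]; trivial
    have hW' : Wc ∈ closure ((Submodule.span ℂ (Set.range (@fourier (1:ℝ))) : Submodule ℂ _) : Set _) := hW
    obtain ⟨p, hp, hd⟩ := Metric.mem_closure_iff.1 hW' 0.005 (by norm_num)
    exact ⟨p, hp, by rwa [dist_eq_norm] at hd⟩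
  have t1 := tend_span p hp
  have t1' := (Complex.continuous_re.tendsto _).comp t1
  have t0 := tend_fourier 0
  have t0' := ((Complex.continuous_re.tendsto _).comp t0).const_mul 0.005
  have t2 := (t1'.add t0').const_mul 2
  -- lower bound
  have t3 : Tendsto (fun σ : ℝ => 1.5 * (2:ℝ) ^ (-(r0 * (σ - 1)))) (𝓝[>] 1) (𝓝 (1.5 * (2:ℝ) ^ (-(r0 * ((1:ℝ) - 1))))) := by
    have : Continuous (fun σ : ℝ => 1.5 * (2:ℝ) ^ (-(r0 * (σ - 1)))) := by
      refine continuous_const.mul (Continuous.rpow continuous_const (by fun_prop) (fun x => Or.inl (by norm_num)))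
    exact (this.tendsto 1).mono_left nhdsWithin_le_nhds
  have key : ∀ᶠ σ : ℝ in 𝓝[>] 1, 1.5 * (2:ℝ) ^ (-(r0 * (σ - 1))) ≤
      2 * ((Complex.re ∘ fun σ : ℝ => ((σ:ℂ) - 1) * ∑' n : ℕ, ((Lam n * (n:ℝ) ^ (-σ) : ℝ) : ℂ) * p ((Real.logb 2 n : ℝ) : AddCircle (1:ℝ))) σ
       + 0.005 * (Complex.re ∘ fun σ : ℝ => ((σ:ℂ) - 1) * ∑' n : ℕ, ((Lam n * (n:ℝ) ^ (-σ) : ℝ) : ℂ) * fourier 0 ((Real.logb 2 n : ℝ) : AddCircle (1:ℝ))) σ) := by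
    filter_upwards [self_mem_nhdsWithin] with σ hσ
    have hσ : 1 < σ := hσ
    set G := ∑' n : ℕ, Lam n * (n:ℝ) ^ (-σ) * (Wc ((Real.logb 2 n : ℝ) : AddCircle (1:ℝ))).re with hG
    have hGre : (∑' n : ℕ, ((Lam n * (n:ℝ) ^ (-σ) : ℝ) : ℂ) * Wc ((Real.logb 2 n : ℝ) : AddCircle (1:ℝ))).re = G := by
      rw [Complex.re_tsum (summ_g hσ Wc)]
      simp only [Complex.re_ofReal_mul, hG]
    set P := ∑' n : ℕ, ((Lam n * (n:ℝ) ^ (-σ) : ℝ) : ℂ) * p ((Real.logb 2 n : ℝ) : AddCircle (1:ℝ)) with hP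
    set A := ∑' n : ℕ, Lam n * (n:ℝ) ^ (-σ) with hA
    have hA' : ∑' n : ℕ, ((Lam n * (n:ℝ) ^ (-σ) : ℝ) : ℂ) * fourier 0 ((Real.logb 2 n : ℝ) : AddCircle (1:ℝ)) = (A : ℂ) := by
      simp only [fourier_zero, mul_one]
      rw [hA, Complex.ofReal_tsum]
    have hdiff : G - P.re ≤ 0.005 * A := by
      rw [← hGre, ← Complex.sub_re, hP, ← (summ_g hσ Wc).tsum_sub (summ_g hσ p)]
      refine (Complex.re_le_norm _).trans ?_
      rw [hA, ← tsum_mul_left]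
      refine tsum_of_norm_bounded ((summ_L hσ).mul_left _).hasSum fun n => ?_
      rw [← mul_sub, norm_mul]
      have h0 : 0 ≤ Lam n * (n:ℝ) ^ (-σ) := mul_nonneg ArithmeticFunction.vonMangoldt_nonneg (by positivity)
      rw [Complex.norm_real, Real.norm_of_nonneg h0, mul_comm]
      refine mul_le_mul_of_nonneg_right ?_ h0
      exact ((Wc - p).norm_coe_le_norm _).trans hpW.le
    -- geometric lower bound
    set q : ℝ := (2:ℝ) ^ (-(σ - 1)) with hq
    have hq0 : 0 < q := by positivity
    have hq1 : q < 1 := Real.rpow_lt_one_of_one_lt_of_neg (by norm_num) (by linarith)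
    have hlow : ∀ R : ℕ, 1.5 * Real.log 2 * (q ^ r0 * ∑ i ∈ range R, q ^ i) ≤ 2 * G := by
      intro R
      refine le_trans ?_ (psi_sum_bound hσ (r0 + R))
      rw [Finset.mul_sum, Finset.mul_sum, ← Finset.sum_range_add_sum_Ico _ (Nat.le_add_right r0 R)]
      have h0 : 0 ≤ ∑ r ∈ range r0, Chebyshev.psi (2 ^ r) * (2:ℝ) ^ (-(r * σ)) :=
        Finset.sum_nonneg fun r _ => mul_nonneg (Chebyshev.psi_nonneg _) (by positivity)
      refine le_trans ?_ (le_add_of_nonneg_left h0)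
      rw [Finset.sum_Ico_eq_sum_range]
      simp only [Nat.add_sub_cancel_left]
      apply Finset.sum_le_sum
      intro i _
      have h1 := hcon (r0 + i) (Nat.le_add_right _ _)
      have h2 : q ^ r0 * q ^ i = 2 ^ (r0 + i) * (2:ℝ) ^ (-((r0 + i : ℕ) * σ)) := by
        rw [← pow_add, hq, ← Real.rpow_natCast, ← Real.rpow_natCast, ← Real.rpow_mul (by norm_num), ← Real.rpow_add (by norm_num)]
        congr 1
        push_cast
        ring
      rw [h2, ← mul_assoc]
      exact mul_le_mul_of_nonneg_right h1 (by positivity)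
    have hlow2 : 1.5 * Real.log 2 * (q ^ r0 * (1 - q)⁻¹) ≤ 2 * G := by
      have := ((hasSum_geometric_of_lt_one hq0.le hq1).tendsto_sum_nat.const_mul (q ^ r0)).const_mul (1.5 * Real.log 2)
      exact le_of_tendsto' this hlow
    have hq2 : 1 - q ≤ Real.log 2 * (σ - 1) := by
      have : q = Real.exp (-(Real.log 2 * (σ - 1))) := by
        rw [hq, Real.rpow_def_of_pos (by norm_num)]; congr 1; ring
      have h := Real.add_one_le_exp (-(Real.log 2 * (σ - 1)))
      rw [this]; linarith
    have hpr : (2:ℝ) ^ (-(r0 * (σ - 1))) = q ^ r0 := by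
      rw [hq, ← Real.rpow_natCast, ← Real.rpow_mul (by norm_num)]; congr 1; ring
    have hfin : 1.5 * q ^ r0 ≤ 2 * ((σ - 1) * G) := by
      have h1 : 1 ≤ Real.log 2 * (σ - 1) * (1 - q)⁻¹ := by
        rw [← div_eq_mul_inv, le_div_iff₀ (by linarith)]; linarith
      have h2 := mul_le_mul_of_nonneg_left hlow2 (by linarith : 0 ≤ σ - 1)
      have h3 := mul_le_mul_of_nonneg_left h1 (by positivity : 0 ≤ 1.5 * q ^ r0)
      calc 1.5 * q ^ r0 = 1.5 * q ^ r0 * 1 := by ring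
        _ ≤ _ := h3
        _ = (σ - 1) * (1.5 * Real.log 2 * (q ^ r0 * (1 - q)⁻¹)) := by ring
        _ ≤ _ := h2
        _ = _ := by ring
    rw [hpr]
    refine hfin.trans ?_
    simp only [Function.comp]
    rw [hA', ← Complex.ofReal_one, ← Complex.ofReal_sub, Complex.re_ofReal_mul, Complex.re_ofReal_mul, Complex.ofReal_re]
    have := mul_le_mul_of_nonneg_left hdiff (by linarith : 0 ≤ σ - 1)
    linarith
  have hfinal := le_of_tendsto_of_tendsto t3 t2 key
  have hF0 : fourierCoeff (fourier 0 : AddCircle (1:ℝ) → ℂ) 0 = 1 := by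
    rw [fourierCoeff_fourier]; simp
  rw [hF0] at hfinal
  have hre : (fourierCoeff (p : AddCircle (1:ℝ) → ℂ) 0).re ≤ 0.732 + 0.005 := by
    have h1 := fc_norm_le (Wc - p)
    have h2 := (Complex.abs_re_le_norm _).trans (h1.trans hpW.le)
    rw [fc_sub, fc_W, Complex.sub_re, Complex.ofReal_re, abs_le] at h2
    have := wfun_integral
    linarith [h2.1]
  norm_num at hfinal hre
  linarith

theorem lcm_small (r0 : ℕ) : ∃ r ≥ r0, (Nat.lcmUpto (2 ^ r)) ^ 2 < 8 ^ (2 ^ r) := by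
  obtain ⟨r, hr, h⟩ := psi_small r0
  refine ⟨r, hr, ?_⟩
  have h1 := Chebyshev.psi_eq_log_lcmUpto (2 ^ r)
  push_cast at h1
  rw [h1] at h
  have hpos : (0:ℝ) < Nat.lcmUpto (2 ^ r) := by exact_mod_cast Nat.lcmUpto_pos _
  have : Real.log ((Nat.lcmUpto (2 ^ r) : ℝ) ^ 2) < Real.log ((8:ℝ) ^ (2 ^ r)) := by
    rw [Real.log_pow, Real.log_pow, show (8:ℝ) = 2 ^ 3 by norm_num, Real.log_pow]
    push_cast
    linarith
  have := (Real.log_lt_log_iff (by positivity) (by positivity)).1 this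
  exact_mod_cast this

end PartP
end Z2

namespace Z2
section PartA

/-- the numerator product -/
def bnum (n m : ℕ) : ℚ := ∏ j ∈ range n, (4 * ((j:ℚ) + 1 - m) - 1)
def bden (n m : ℕ) : ℚ := ∏ k ∈ range (n + 1), if k = m then 1 else ((k:ℚ) - m)
def beta (n m : ℕ) : ℚ := bnum n m / bden n m

lemma prod_refl_fact (m : ℕ) : ∏ k ∈ range m, ((m:ℚ) - k) = (m.factorial : ℚ) := by
  rw [← Finset.prod_range_reflect, ← Finset.prod_range_add_one_eq_factorial]
  push_cast
  apply Finset.prod_congr rfl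
  intro j hj
  have : j < m := Finset.mem_range.1 hj
  have : m - 1 - j = m - (j + 1) := by omega
  rw [this, Nat.cast_sub (by omega)]
  push_cast; ring

lemma bden_abs (m l : ℕ) : |bden (m + l) m| = m.factorial * l.factorial := by
  unfold bden
  rw [show m + l + 1 = m + (1 + l) by ring, Finset.prod_range_add, Finset.prod_range_add, abs_mul]
  congr 1
  · rw [← prod_refl_fact, Finset.abs_prod]
    apply Finset.prod_congr rfl
    intro k hk
    have : k < m := Finset.mem_range.1 hk
    have h2 : (k:ℚ) < m := by exact_mod_cast this
    rw [if_neg (by omega), abs_sub_comm, abs_of_pos (by linarith)]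
  · simp only [Finset.prod_range_one, add_zero, if_true, one_mul]
    rw [← Finset.prod_range_add_one_eq_factorial, Finset.abs_prod]
    push_cast
    apply Finset.prod_congr rfl
    intro k hk
    have h0 : (0:ℚ) ≤ k := by positivity
    rw [if_neg (by omega)]
    push_cast
    rw [abs_of_pos (by linarith)]
    ring

lemma bden_ne (m l : ℕ) : bden (m + l) m ≠ 0 := by
  have := bden_abs m l
  intro h
  rw [h, abs_zero] at this
  have h2 : (0:ℚ) < m.factorial * l.factorial := by
    have := m.factorial_pos; have := l.factorial_pos; positivity
  linarith

lemma bnum_abs (m l : ℕ) : |bnum (m + l) m| ≤ 4 ^ (m + l) * (m.factorial * l.factorial) := by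
  unfold bnum
  rw [Finset.prod_range_add, abs_mul, pow_add]
  rw [show (4:ℚ) ^ m * 4 ^ l * (m.factorial * l.factorial) = (4 ^ m * m.factorial) * (4 ^ l * l.factorial) by ring]
  gcongr
  · rw [← prod_refl_fact, Finset.abs_prod, Finset.pow_eq_prod_const (4:ℚ) m, ← Finset.prod_mul_distrib]
    apply Finset.prod_le_prod (fun _ _ => abs_nonneg _)
    intro k hk
    have : k < m := Finset.mem_range.1 hk
    have h2 : (k:ℚ) + 1 ≤ m := by exact_mod_cast this
    rw [abs_le]; constructor <;> linarith
  · rw [← Finset.prod_range_add_one_eq_factorial, Finset.abs_prod, Finset.pow_eq_prod_const (4:ℚ) l]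
    push_cast
    rw [← Finset.prod_mul_distrib]
    apply Finset.prod_le_prod (fun _ _ => abs_nonneg _)
    intro k hk
    have h2 : (0:ℚ) ≤ k := by positivity
    rw [abs_le]; push_cast; constructor <;> linarith

lemma beta_abs {n m : ℕ} (h : m ≤ n) : |beta n m| ≤ 4 ^ n := by
  obtain ⟨l, rfl⟩ := Nat.exists_eq_add_of_le h
  unfold beta
  rw [abs_div, bden_abs, div_le_iff₀]
  · exact bnum_abs m l
  · have := m.factorial_pos; have := l.factorial_pos; positivity

lemma fact_dvd (n : ℕ) (c : ℤ) : (n.factorial : ℤ) ∣ 2 ^ n * ∏ j ∈ range n, (4 * (j:ℤ) + c) := by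
  obtain ⟨v, q, hq, hv⟩ := Nat.exists_eq_two_pow_mul_odd (n := n.factorial) n.factorial_ne_zero
  have hvn : v ≤ n := by
    have h1 : 2 ^ v ∣ n.factorial := ⟨q, hv⟩
    have h2 := (padicValNat_dvd_iff_le (p := 2) n.factorial_ne_zero).1 h1
    have h3 := sub_one_mul_padicValNat_factorial (p := 2) n
    omega
  rw [hv]
  push_cast
  apply mul_dvd_mul (pow_dvd_pow _ hvn)
  have hcop : IsCoprime (4:ℤ) (q:ℤ) := by
    have : Nat.Coprime 4 q := by
      have : Nat.Coprime (2^2) q := Nat.Coprime.pow_left 2 (Nat.coprime_two_left.2 hq)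
      exact this
    exact_mod_cast Nat.isCoprime_iff_coprime.2 this
  obtain ⟨a, b, hab⟩ := hcop
  have hq0 : (q:ℤ) ≠ 0 := by
    rintro h
    have : q = 0 := by exact_mod_cast h
    subst this; simp at hq
  set c' := ((a * c) % q).toNat with hc'
  have hc'' : (c' : ℤ) = (a * c) % q := Int.toNat_of_nonneg (Int.emod_nonneg _ hq0)
  have h1 : ∏ j ∈ range n, (4 * (j:ℤ) + c) ≡ ∏ j ∈ range n, (4 * ((c':ℤ) + j)) [ZMOD q] := by
    apply Int.ModEq.prod
    intro j _
    have : 4 * (c':ℤ) ≡ c [ZMOD q] := by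
      rw [hc'']
      have e1 : (a * c) % q ≡ a * c [ZMOD q] := Int.mod_modEq _ _
      have e2 := e1.mul_left 4
      refine e2.trans ?_
      apply (Int.modEq_iff_dvd).2
      refine ⟨b * c, ?_⟩
      linear_combination (-c) * hab
    have := (this.add_left (4 * (j:ℤ))).symm
    rw [mul_add, add_comm (4 * (c':ℤ))]; exact this
  have h2 : (q:ℤ) ∣ ∏ j ∈ range n, (4 * ((c':ℤ) + j)) := by
    rw [Finset.prod_mul_distrib]
    apply Dvd.dvd.mul_left
    have h3 : (n.factorial) ∣ ∏ j ∈ range n, (c' + j) := by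
      rw [← Nat.ascFactorial_eq_prod_range]
      exact Nat.factorial_dvd_ascFactorial c' n
    have h4 : q ∣ ∏ j ∈ range n, (c' + j) := (Dvd.intro_left _ hv.symm).trans h3
    have h5 : (q:ℤ) ∣ ((∏ j ∈ range n, (c' + j) : ℕ) : ℤ) := Int.natCast_dvd_natCast.2 h4
    push_cast at h5
    exact h5
  exact (Int.ModEq.dvd_iff h1).2 h2

lemma beta_int {n m : ℕ} (h : m ≤ n) : ∃ z : ℤ, 2 ^ n * beta n m = z := by
  obtain ⟨l, rfl⟩ := Nat.exists_eq_add_of_le h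
  obtain ⟨z, hz⟩ := fact_dvd (m + l) (3 - 4 * m)
  have hC : ((m + l).factorial : ℚ) = (m+l).choose m * (m.factorial * l.factorial) := by
    have := Nat.choose_mul_factorial_mul_factorial h
    rw [Nat.add_sub_cancel_left] at this
    rw [← this]; push_cast; ring
  have hz' : (2:ℚ) ^ (m + l) * bnum (m + l) m = (m + l).factorial * z := by
    have := congrArg (fun t : ℤ => (t : ℚ)) hz
    push_cast at this
    rw [← this]
    unfold bnum
    congr 1
    apply Finset.prod_congr rfl
    intro j _
    ring
  have hne := bden_ne m l
  unfold beta
  rw [← mul_div_assoc, hz', hC]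
  rw [← bden_abs]
  rcases abs_choice (bden (m + l) m) with e | e
  · refine ⟨(m+l).choose m * z, ?_⟩
    rw [e]; push_cast; field_simp
  · refine ⟨-((m+l).choose m * z), ?_⟩
    rw [e]; push_cast; field_simp

lemma poly_identity (n : ℕ) :
    (∏ j ∈ range n, (4 * Polynomial.X + Polynomial.C (4 * (j:ℚ) + 3))) =
      ∑ m ∈ range (n + 1), Polynomial.C (beta n m) *
        ∏ k ∈ range (n + 1), (if k = m then 1 else (Polynomial.X + Polynomial.C (k:ℚ))) := by
  have hinj : Set.InjOn (fun k : ℕ => -(k:ℚ)) (range (n + 1)) := by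
    intro a _ b _ h
    simpa using h
  apply Polynomial.eq_of_degrees_lt_of_eval_index_eq (range (n + 1)) hinj
  · refine lt_of_le_of_lt (Polynomial.degree_prod_le _ _) ?_
    refine lt_of_le_of_lt (Finset.sum_le_card_nsmul _ _ 1 ?_) ?_
    · intro j _
      refine (Polynomial.degree_add_le _ _).trans ?_
      refine max_le ?_ (Polynomial.degree_C_le.trans (by norm_num))
      have : (4 * Polynomial.X : Polynomial ℚ) = Polynomial.C 4 * Polynomial.X := rfl
      rw [this]
      exact Polynomial.degree_C_mul_X_le _
    · rw [Finset.card_range, Finset.card_range, nsmul_one]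
      exact_mod_cast Nat.lt_succ_self n
  · refine lt_of_le_of_lt (b := (n : WithBot ℕ)) ?_ ?_
    · refine (Polynomial.degree_sum_le _ _).trans ?_
      refine Finset.sup_le fun m hm => ?_
      refine (Polynomial.degree_mul_le _ _).trans ((add_le_add_left Polynomial.degree_C_le _).trans ?_)
      rw [zero_add]
      rw [← Finset.mul_prod_erase _ _ hm]
      rw [if_pos rfl, one_mul]
      refine (Polynomial.degree_prod_le _ _).trans ?_
      refine (Finset.sum_le_card_nsmul _ _ 1 ?_).trans ?_
      · intro k hk
        rw [if_neg (Finset.ne_of_mem_erase hk)]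
        exact (Polynomial.degree_X_add_C _).le
      · rw [Finset.card_erase_of_mem hm, Finset.card_range, nsmul_one]
        simp
    · rw [Finset.card_range]
      exact_mod_cast Nat.lt_succ_self n
  · intro m hm
    rw [Polynomial.eval_prod, Polynomial.eval_finsetSum, Finset.sum_eq_single m]
    · rw [Polynomial.eval_mul, Polynomial.eval_C, Polynomial.eval_prod]
      have h1 : ∏ k ∈ range (n + 1), Polynomial.eval (-(m:ℚ)) (if k = m then 1 else (Polynomial.X + Polynomial.C (k:ℚ)))
          = bden n m := by
        unfold bden
        apply Finset.prod_congr rfl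
        intro k _
        split_ifs
        · simp
        · simp; ring
      rw [h1]
      have h2 : bden n m ≠ 0 := by
        obtain ⟨l, rfl⟩ := Nat.exists_eq_add_of_le (Nat.lt_succ_iff.1 (Finset.mem_range.1 hm))
        exact bden_ne m l
      unfold beta
      rw [div_mul_cancel₀ _ h2]
      unfold bnum
      apply Finset.prod_congr rfl
      intro j _
      simp; ring
    · intro k _ hk
      rw [Polynomial.eval_mul, Polynomial.eval_prod]
      rw [Finset.prod_eq_zero hm]
      · simp
      · rw [if_neg (fun h => hk h.symm)]; simp
    · intro h; exact absurd hm h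

variable {A : Type*} [CommRing A] [Algebra ℚ A]

lemma brick_B (n : ℕ) (x : A) (u : ℕ → A) (hu : ∀ k ≤ n, (x + algebraMap ℚ A k) * u k = 1) :
    (∏ j ∈ range n, (4 * x + algebraMap ℚ A (4 * (j:ℚ) + 3))) * ∏ k ∈ range (n + 1), u k =
      ∑ m ∈ range (n + 1), beta n m • u m := by
  have h := congrArg (Polynomial.aeval x) (poly_identity n)
  simp only [map_prod, map_sum, map_add, map_mul, Polynomial.aeval_X, Polynomial.aeval_C, map_ofNat, apply_ite (Polynomial.aeval x), map_one] at h
  have e : (∏ j ∈ range n, (4 * x + algebraMap ℚ A (4 * (j:ℚ) + 3))) = ∏ j ∈ range n, (4 * x + (4 * algebraMap ℚ A j + 3)) := by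
    apply Finset.prod_congr rfl
    intro j _
    rw [map_add, map_mul, map_ofNat, map_ofNat]
  rw [e, h, Finset.sum_mul]
  apply Finset.sum_congr rfl
  intro m hm
  rw [mul_assoc, ← Finset.prod_mul_distrib, Algebra.smul_def]
  congr 1
  rw [← Finset.mul_prod_erase _ _ hm, if_pos rfl, one_mul, Finset.prod_eq_one, mul_one]
  intro k hk
  rw [if_neg (Finset.ne_of_mem_erase hk)]
  exact hu k (Nat.lt_succ_iff.1 (Finset.mem_range.1 (Finset.mem_of_mem_erase hk)))

end PartA
end Z2

namespace Z2
section PartA2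
variable {A : Type*} [CommRing A] [Algebra ℚ A]

def Rep (n N d : ℕ) (u : ℕ → A) (h : ℕ) (G Bd σ : ℚ) (f : A) : Prop :=
  ∃ a : ℕ → ℕ → ℚ, f = ∑ k ∈ range (n + 1), ∑ i ∈ range N, a k i • u k ^ (i + 1) ∧
    (∀ k i, h ≤ i → a k i = 0) ∧ (∀ k i, ∃ z : ℤ, G * d ^ h * a k i = d ^ (i + 1) * z) ∧
    ∑ k ∈ range (n + 1), ∑ i ∈ range N, |a k i| ≤ Bd ∧ ∑ k ∈ range (n + 1), a k 0 = σ

variable {n N d : ℕ} {u : ℕ → A}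

lemma Rep.congr {h h' : ℕ} {G Bd σ G' Bd' σ' : ℚ} {f f' : A} (H : Rep n N d u h G Bd σ f)
    (hh : h = h') (hG : G = G') (hB : Bd ≤ Bd') (hs : σ = σ') (hf : f = f') : Rep n N d u h' G' Bd' σ' f' := by
  subst hh hG hs hf
  obtain ⟨a, h1, h2, h3, h4, h5⟩ := H
  exact ⟨a, h1, h2, h3, h4.trans hB, h5⟩

lemma Rep.mono {h h' : ℕ} {G Bd σ : ℚ} {f : A} (H : Rep n N d u h G Bd σ f) (hh : h ≤ h') :
    Rep n N d u h' G Bd σ f := by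
  obtain ⟨a, h1, h2, h3, h4, h5⟩ := H
  refine ⟨a, h1, fun k i hi => h2 k i (hh.trans hi), fun k i => ?_, h4, h5⟩
  obtain ⟨z, hz⟩ := h3 k i
  obtain ⟨l, rfl⟩ := Nat.exists_eq_add_of_le hh
  refine ⟨d ^ l * z, ?_⟩
  push_cast
  rw [pow_add]
  linear_combination (d:ℚ) ^ l * hz

lemma Rep.zero (h : ℕ) (G : ℚ) : Rep n N d u h G 0 0 0 :=
  ⟨fun _ _ => 0, by simp, by simp, fun _ _ => ⟨0, by simp⟩, by simp, by simp⟩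

lemma Rep.add {h : ℕ} {G B1 s1 B2 s2 : ℚ} {f g : A} (Hf : Rep n N d u h G B1 s1 f) (Hg : Rep n N d u h G B2 s2 g) :
    Rep n N d u h G (B1 + B2) (s1 + s2) (f + g) := by
  obtain ⟨a, h1, h2, h3, h4, h5⟩ := Hf
  obtain ⟨b, k1, k2, k3, k4, k5⟩ := Hg
  refine ⟨fun k i => a k i + b k i, ?_, ?_, ?_, ?_, ?_⟩
  · rw [h1, k1, ← Finset.sum_add_distrib]
    refine Finset.sum_congr rfl fun k _ => ?_
    rw [← Finset.sum_add_distrib]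
    exact Finset.sum_congr rfl fun i _ => (add_smul _ _ _).symm
  · intro k i hi
    simp only [h2 k i hi, k2 k i hi, add_zero]
  · intro k i
    obtain ⟨z, hz⟩ := h3 k i
    obtain ⟨w, hw⟩ := k3 k i
    exact ⟨z + w, by push_cast; linear_combination hz + hw⟩
  · refine le_trans ?_ (add_le_add h4 k4)
    rw [← Finset.sum_add_distrib]
    refine Finset.sum_le_sum fun k _ => ?_
    rw [← Finset.sum_add_distrib]
    exact Finset.sum_le_sum fun i _ => abs_add_le _ _
  · rw [← h5, ← k5, Finset.sum_add_distrib]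

lemma Rep.sum {ι : Type*} {h : ℕ} {G : ℚ} (S : Finset ι) (B s : ι → ℚ) (f : ι → A)
    (H : ∀ j ∈ S, Rep n N d u h G (B j) (s j) (f j)) :
    Rep n N d u h G (∑ j ∈ S, B j) (∑ j ∈ S, s j) (∑ j ∈ S, f j) := by
  classical
  induction S using Finset.induction_on with
  | empty => simpa using Rep.zero h G
  | insert a S ha ih =>
    rw [Finset.sum_insert ha, Finset.sum_insert ha, Finset.sum_insert ha]
    exact (H a (Finset.mem_insert_self _ _)).add (ih fun j hj => H j (Finset.mem_insert_of_mem hj))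

lemma Rep.smul {h1 h2 : ℕ} {G B s c : ℚ} {f : A} (H : Rep n N d u h1 1 B s f)
    (hc : ∃ z : ℤ, G * d ^ h2 * c = z) : Rep n N d u (h1 + h2) G (|c| * B) (c * s) (c • f) := by
  obtain ⟨a, k1, k2, k3, k4, k5⟩ := H
  obtain ⟨w, hw⟩ := hc
  refine ⟨fun k i => c * a k i, ?_, ?_, ?_, ?_, ?_⟩
  · rw [k1, Finset.smul_sum]
    refine Finset.sum_congr rfl fun k _ => ?_
    rw [Finset.smul_sum]
    exact Finset.sum_congr rfl fun i _ => smul_smul _ _ _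
  · intro k i hi
    simp only [k2 k i (by omega), mul_zero]
  · intro k i
    obtain ⟨z, hz⟩ := k3 k i
    refine ⟨w * z, ?_⟩
    push_cast
    rw [pow_add]
    linear_combination (d:ℚ)^h1 * a k i * hw + (w:ℚ) * hz
  · refine le_trans ?_ (mul_le_mul_of_nonneg_left k4 (abs_nonneg c))
    simp only [abs_mul, Finset.mul_sum, le_refl]
  · rw [← k5, Finset.mul_sum]

lemma Rep.upow {k i : ℕ} (hk : k ≤ n) (hi : i < N) :
    Rep n N d u (i + 1) 1 1 (if i = 0 then 1 else 0) (u k ^ (i + 1)) := by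
  refine ⟨fun k' i' => if k' = k ∧ i' = i then 1 else 0, ?_, ?_, ?_, ?_, ?_⟩
  · rw [Finset.sum_eq_single k, Finset.sum_eq_single i]
    · simp
    · intro b _ hb; simp [hb]
    · intro hb; exact absurd (Finset.mem_range.2 hi) hb
    · intro b _ hb
      exact Finset.sum_eq_zero fun _ _ => by simp [hb]
    · intro hb; exact absurd (Finset.mem_range.2 (by omega)) hb
  · intro k' i' h
    exact if_neg (by omega)
  · intro k' i'
    by_cases h : k' = k ∧ i' = i
    · exact ⟨1, by simp [h]⟩
    · exact ⟨0, by simp [h]⟩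
  · rw [Finset.sum_eq_single k, Finset.sum_eq_single i]
    · simp
    · intro b _ hb; simp [hb]
    · intro hb; exact absurd (Finset.mem_range.2 hi) hb
    · intro b _ hb
      exact Finset.sum_eq_zero fun _ _ => by simp [hb]
    · intro hb; exact absurd (Finset.mem_range.2 (by omega)) hb
  · rw [Finset.sum_eq_single k]
    · simp [eq_comm]
    · intro b _ hb; simp [hb]
    · intro hb; exact absurd (Finset.mem_range.2 (by omega)) hb

lemma u_mul (x : A) (hu : ∀ k ≤ n, (x + algebraMap ℚ A k) * u k = 1) {k k' : ℕ} (hk : k ≤ n) (hk' : k' ≤ n) (hne : k ≠ k') :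
    u k * u k' = (1 / ((k':ℚ) - k)) • (u k + (-1 : ℚ) • u k') := by
  have h1 := hu k hk
  have h2 := hu k' hk'
  have hq : ((k':ℚ) - k) ≠ 0 := by
    rw [sub_ne_zero]; exact_mod_cast hne.symm
  have e : u k + (-1 : ℚ) • u k' = ((k':ℚ) - k) • (u k * u k') := by
    rw [Algebra.smul_def, Algebra.smul_def, map_sub, map_neg, map_one]
    linear_combination (-u k) * h2 + u k' * h1
  rw [e, smul_smul, one_div, inv_mul_cancel₀ hq, one_smul]

lemma Rep.upow_mul (x : A) (hu : ∀ k ≤ n, (x + algebraMap ℚ A k) * u k = 1)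
    (hd : ∀ k ≤ n, k ≠ 0 → k ∣ d) {k k' : ℕ} (hk : k ≤ n) (hk' : k' ≤ n) (i : ℕ) (hi : i + 1 < N) :
    Rep n N d u (i + 2) 1 (i + 2) 0 (u k ^ (i + 1) * u k') := by
  by_cases hne : k = k'
  · subst hne
    refine (Rep.upow (d := d) hk hi).congr rfl rfl ?_ (by simp) (by rw [pow_succ _ (i+1)])
    have : (0:ℚ) ≤ i := by positivity
    linarith
  set c : ℚ := 1 / ((k':ℚ) - k) with hcdef
  have hc : ∃ z : ℤ, (1:ℚ) * d ^ 1 * c = z := by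
    rcases lt_or_gt_of_ne hne with h | h
    · obtain ⟨w, hw⟩ := hd (k' - k) (by omega) (by omega)
      refine ⟨w, ?_⟩
      have : (d:ℚ) = ((k':ℚ) - k) * w := by
        rw [hw]; push_cast [Nat.cast_sub h.le]; ring
      have h0 : ((k':ℚ) - k) ≠ 0 := by rw [sub_ne_zero]; exact_mod_cast (Ne.symm hne)
      rw [this, hcdef]; push_cast; field_simp
    · obtain ⟨w, hw⟩ := hd (k - k') (by omega) (by omega)
      refine ⟨-w, ?_⟩
      have : (d:ℚ) = -((k':ℚ) - k) * w := by
        rw [hw]; push_cast [Nat.cast_sub h.le]; ring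
      have h0 : ((k':ℚ) - k) ≠ 0 := by rw [sub_ne_zero]; exact_mod_cast (Ne.symm hne)
      rw [this, hcdef]; push_cast; field_simp
  have hcabs : |c| ≤ 1 := by
    rw [hcdef, abs_div, abs_one, div_le_one]
    · have : (1:ℤ) ≤ |(k':ℤ) - k| := Int.one_le_abs (by omega)
      exact_mod_cast this
    · rw [abs_pos, sub_ne_zero]; exact_mod_cast (Ne.symm hne)
  induction i with
  | zero =>
    have r1 : Rep n N d u 1 1 1 1 (u k) := (Rep.upow (d := d) hk (by omega : 0 < N)).congr rfl rfl le_rfl (by simp) (by simp)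
    have r2 : Rep n N d u 1 1 1 1 (u k') := (Rep.upow (d := d) hk' (by omega : 0 < N)).congr rfl rfl le_rfl (by simp) (by simp)
    have r3 := r2.smul (G := 1) (h2 := 0) (c := -1) ⟨-1, by simp⟩
    have r4 := (r1.add r3).smul (G := 1) (h2 := 1) hc
    refine r4.congr rfl rfl ?_ (by simp) ?_
    · norm_num; linarith
    · rw [zero_add, pow_one]; exact (u_mul x hu hk hk' hne).symm
  | succ i ih =>
    have r1 := Rep.upow (n := n) (N := N) (d := d) (u := u) hk (by omega : i + 1 < N)
    have r2 := (ih (by omega)).smul (G := 1) (h2 := 0) (c := -1) ⟨-1, by simp⟩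
    have r4 := (r1.add r2).smul (G := 1) (h2 := 1) hc
    refine r4.congr rfl rfl ?_ (by simp) ?_
    · push_cast
      have : (0:ℚ) ≤ i := by positivity
      norm_num
      have := mul_le_mul_of_nonneg_right hcabs (by linarith : (0:ℚ) ≤ 1 + (i + 2))
      linarith
    · rw [pow_succ _ (i+1), mul_assoc, u_mul x hu hk hk' hne]
      simp only [Algebra.smul_def]
      rw [← hcdef]
      ring

lemma Rep.mul (x : A) (hu : ∀ k ≤ n, (x + algebraMap ℚ A k) * u k = 1) (hd0 : d ≠ 0)
    (hd : ∀ k ≤ n, k ≠ 0 → k ∣ d) {h : ℕ} {G B σ : ℚ} {f : A} (H : Rep n N d u h G B σ f) (hh : h < N)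
    (γ b G' : ℚ) (β : ℕ → ℚ) (hγ : |γ| ≤ b) (hγ' : ∃ z : ℤ, G' * γ = z)
    (hβ : ∀ k ≤ n, |β k| ≤ b) (hβ' : ∀ k ≤ n, ∃ z : ℤ, G' * β k = z) :
    Rep n N d u (h + 1) (G * G') (B * (b * (1 + (n + 1) * (N + 1)))) (γ * σ)
      (f * (algebraMap ℚ A γ + ∑ k ∈ range (n + 1), β k • u k)) := by
  obtain ⟨a, h1, h2, h3, h4, h5⟩ := H
  have hb0 : 0 ≤ b := (abs_nonneg _).trans hγ
  have hdq : (d:ℚ) ≠ 0 := by exact_mod_cast hd0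
  have h3' : ∀ k i, i < h → ∃ z : ℤ, G * d ^ (h - 1 - i) * a k i = z := by
    intro k i hi
    obtain ⟨z, hz⟩ := h3 k i
    refine ⟨z, ?_⟩
    have e : (d:ℚ) ^ h = d ^ (i + 1) * d ^ (h - 1 - i) := by rw [← pow_add]; congr 1; omega
    rw [e] at hz
    apply mul_left_cancel₀ (pow_ne_zero (i + 1) hdq)
    linear_combination hz
  have key : ∀ k ∈ range (n + 1), ∀ i ∈ range N, Rep n N d u (h + 1) (G * G')
      (|a k i| * (b * (1 + (n + 1) * (N + 1)))) (γ * (if i = 0 then a k i else 0))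
      (a k i • (u k ^ (i + 1) * (algebraMap ℚ A γ + ∑ k ∈ range (n + 1), β k • u k))) := by
    intro k hk i hi
    have hk : k ≤ n := by simpa [Nat.lt_succ_iff] using hk
    have hi : i < N := by simpa using hi
    by_cases hih : h ≤ i
    · rw [h2 k i hih]
      simpa using Rep.zero (h + 1) (G * G')
    · push Not at hih
      obtain ⟨z, hz⟩ := h3' k i hih
      have r1 : Rep n N d u (h + 1) (G * G') (|a k i * γ| * 1) (a k i * γ * (if i = 0 then 1 else 0))
          ((a k i * γ) • u k ^ (i + 1)) := by
        obtain ⟨w, hw⟩ := hγ'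
        have := (Rep.upow (n := n) (N := N) (d := d) (u := u) hk hi).smul (G := G * G') (h2 := h - 1 - i) (c := a k i * γ)
          ⟨z * w, by push_cast; rw [← hz, ← hw]; ring⟩
        exact this.mono (by omega)
      have r2 : Rep n N d u (h + 1) (G * G') (∑ k' ∈ range (n + 1), |a k i * β k'| * (i + 2)) (∑ k' ∈ range (n + 1), a k i * β k' * 0)
          (∑ k' ∈ range (n + 1), (a k i * β k') • (u k ^ (i + 1) * u k')) := by
        apply Rep.sum
        intro k' hk'
        have hk' : k' ≤ n := by simpa [Nat.lt_succ_iff] using hk'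
        obtain ⟨w, hw⟩ := hβ' k' hk'
        have := (Rep.upow_mul (N := N) x hu hd hk hk' i (by omega)).smul (G := G * G') (h2 := h - 1 - i) (c := a k i * β k')
          ⟨z * w, by push_cast; rw [← hz, ← hw]; ring⟩
        exact this.congr (by omega) rfl le_rfl rfl rfl
      refine (r1.add r2).congr rfl rfl ?_ ?_ ?_
      · have e1 : |a k i * γ| * 1 ≤ |a k i| * b := by
          rw [mul_one, abs_mul]; gcongr
        have e2 : ∑ k' ∈ range (n + 1), |a k i * β k'| * ((i:ℚ) + 2) ≤ ∑ k' ∈ range (n + 1), |a k i| * b * (N + 1) := by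
          apply Finset.sum_le_sum
          intro k' hk'
          have hk' : k' ≤ n := by simpa [Nat.lt_succ_iff] using hk'
          rw [abs_mul]
          have : (i:ℚ) + 2 ≤ N + 1 := by
            have : i + 2 ≤ N + 1 := by omega
            exact_mod_cast this
          have := hβ k' hk'
          gcongr
        rw [Finset.sum_const, Finset.card_range, nsmul_eq_mul] at e2
        push_cast at e2
        calc _ ≤ _ := add_le_add e1 e2
          _ = _ := by ring
      · simp only [mul_zero, Finset.sum_const_zero, add_zero]
        split_ifs <;> ring
      · rw [mul_add, smul_add, Finset.mul_sum, Finset.smul_sum]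
        congr 1
        · simp only [Algebra.smul_def, map_mul]; ring
        · refine Finset.sum_congr rfl fun k' _ => ?_
          simp only [Algebra.smul_def, map_mul]; ring
  have tot := Rep.sum (range (n + 1)) _ _ _ (fun k hk => Rep.sum (range N) _ _ _ (key k hk))
  refine tot.congr rfl rfl ?_ ?_ ?_
  · simp only [← Finset.sum_mul]
    gcongr
  · simp only [← Finset.mul_sum]
    rw [← h5]
    congr 1
    apply Finset.sum_congr rfl
    intro k _
    rw [Finset.sum_ite_eq']
    rw [if_pos (Finset.mem_range.2 (by omega))]
  · rw [h1, Finset.sum_mul]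
    refine Finset.sum_congr rfl fun k' _ => ?_
    rw [Finset.sum_mul]
    refine Finset.sum_congr rfl fun i _ => ?_
    rw [smul_mul_assoc]

/-- `(4x-1) B` as a brick. -/
lemma brick_xB (n : ℕ) (x : A) (u : ℕ → A) (hu : ∀ k ≤ n, (x + algebraMap ℚ A k) * u k = 1) :
    (4 * x - 1) * ∑ m ∈ range (n + 1), beta n m • u m =
      algebraMap ℚ A (4 * ∑ m ∈ range (n + 1), beta n m) +
        ∑ m ∈ range (n + 1), (-(4 * m + 1) * beta n m) • u m := by
  rw [map_mul, map_sum, Finset.mul_sum, Finset.mul_sum, ← Finset.sum_add_distrib]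
  apply Finset.sum_congr rfl
  intro m hm
  have h := hu m (by simpa [Nat.lt_succ_iff] using hm)
  simp only [Algebra.smul_def, map_mul, map_neg, map_add, map_one, map_ofNat]
  linear_combination 4 * algebraMap ℚ A (beta n m) * h

def KB (s n : ℕ) : ℕ := (4 * (n + 1) * 4 ^ n) ^ (s + 2) * (1 + (n + 1) * (s + 3)) ^ (s + 1)

theorem rep_R (s n d : ℕ) (hd0 : d ≠ 0) (hd : ∀ k ≤ n, k ≠ 0 → k ∣ d) (x : A) (u : ℕ → A)
    (hu : ∀ k ≤ n, (x + algebraMap ℚ A k) * u k = 1) :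
    Rep n (s + 2) d u (s + 2) ((2 ^ n) ^ (s + 2)) (KB s n) 0
      ((4 * x - 1) ^ s * ((∏ j ∈ range n, (4 * x + algebraMap ℚ A (4 * (j:ℚ) + 3))) *
        ∏ k ∈ range (n + 1), u k) ^ (s + 2)) := by
  rw [brick_B n x u hu]
  set B := ∑ m ∈ range (n + 1), beta n m • u m with hB
  set b : ℚ := 4 * (n + 1) * 4 ^ n with hb
  set K : ℚ := 1 + (n + 1) * (((s + 2 : ℕ) : ℚ) + 1) with hK
  have hK0 : 0 ≤ K := by positivity
  have hbb : (4:ℚ) ^ n ≤ b := by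
    have : (1:ℚ) ≤ 4 * (n + 1) := by
      have : (0:ℚ) ≤ n := by positivity
      linarith
    calc (4:ℚ)^n = 1 * 4 ^ n := by ring
      _ ≤ _ := by rw [hb]; gcongr
  have hβ : ∀ k ≤ n, |beta n k| ≤ b := fun k hk => (beta_abs hk).trans hbb
  -- B itself
  have r1 : Rep n (s + 2) d u 1 (2 ^ n) b (∑ m ∈ range (n + 1), beta n m) B := by
    have := Rep.sum (n := n) (N := s + 2) (d := d) (u := u) (h := 1) (G := 2 ^ n) (range (n + 1)) (fun m => |beta n m| * 1) (fun m => beta n m * 1) (fun m => beta n m • u m) (by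
      intro m hm
      have hm : m ≤ n := by simpa [Nat.lt_succ_iff] using hm
      obtain ⟨z, hz⟩ := beta_int hm
      have r : Rep n (s + 2) d u 1 1 1 1 (u m) := (Rep.upow (d := d) hm (by omega : 0 < s + 2)).congr rfl rfl le_rfl (by simp) (by simp)
      exact r.smul (h2 := 0) (G := 2 ^ n) ⟨z, by simpa using hz⟩)
    refine this.congr rfl rfl ?_ (by simp) rfl
    calc ∑ m ∈ range (n + 1), |beta n m| * 1 ≤ ∑ m ∈ range (n + 1), (4:ℚ) ^ n := by
          apply Finset.sum_le_sum
          intro m hm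
          rw [mul_one]
          exact beta_abs (by simpa [Nat.lt_succ_iff] using hm)
      _ = (n + 1) * 4 ^ n := by simp
      _ ≤ b := by
          rw [hb]
          have : (0:ℚ) ≤ (n + 1) * 4 ^ n := by positivity
          linarith
  have r2 : Rep n (s + 2) d u 2 ((2 ^ n) * 2 ^ n) (b * (b * K)) 0 (B * B) := by
    have := r1.mul x hu hd0 hd (by omega) 0 b (2 ^ n) (beta n) (by simpa using (by positivity : 0 ≤ b)) ⟨0, by simp⟩ hβ (fun k hk => beta_int hk)
    refine this.congr rfl rfl ?_ (by simp) (by simp [hB])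
    rw [hK]
  have rs : ∀ t ≤ s, Rep n (s + 2) d u (t + 2) ((2 ^ n) ^ (t + 2)) (b ^ (t + 2) * K ^ (t + 1)) 0 ((4 * x - 1) ^ t * B ^ (t + 2)) := by
    intro t
    induction t with
    | zero =>
      intro _
      refine r2.congr rfl (by ring) (le_of_eq (by ring)) rfl (by ring)
    | succ t ih =>
      intro ht
      have := (ih (by omega)).mul x hu hd0 hd (by omega) (4 * ∑ m ∈ range (n + 1), beta n m) b (2 ^ n)
        (fun m => (-(4 * m + 1) * beta n m)) ?_ ?_ ?_ ?_
      · rw [← brick_xB n x u hu] at this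
        refine this.congr rfl (by ring) (le_of_eq ?_) (by ring) (by rw [← hB]; ring)
        rw [hK]; ring
      · rw [abs_mul, hb, mul_assoc]
        have : |(4:ℚ)| = 4 := by norm_num
        rw [this]
        gcongr
        refine (Finset.abs_sum_le_sum_abs _ _).trans ?_
        calc ∑ m ∈ range (n + 1), |beta n m| ≤ ∑ m ∈ range (n + 1), (4:ℚ) ^ n := by
              apply Finset.sum_le_sum
              intro m hm
              exact beta_abs (by simpa [Nat.lt_succ_iff] using hm)
          _ = (n + 1) * 4 ^ n := by simp
      · choose! z hz using (fun (k : ℕ) (hk : k ∈ range (n + 1)) => beta_int (n := n) (m := k) (by simpa [Nat.lt_succ_iff] using hk))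
        refine ⟨4 * ∑ m ∈ range (n + 1), z m, ?_⟩
        push_cast
        rw [mul_left_comm, Finset.mul_sum, Finset.sum_congr rfl hz]
      · intro k hk
        rw [abs_mul, hb]
        have hk' : (k:ℚ) ≤ n := by exact_mod_cast hk
        have hk0 : (0:ℚ) ≤ k := by positivity
        have : |(-(4 * (k:ℚ) + 1))| ≤ 4 * (n + 1) := by
          rw [abs_neg, abs_of_nonneg (by positivity)]; linarith
        have := beta_abs hk
        gcongr
      · intro k hk
        obtain ⟨z, hz⟩ := beta_int hk
        refine ⟨-(4 * k + 1) * z, ?_⟩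
        push_cast
        rw [← hz]; ring
  refine (rs s le_rfl).congr rfl rfl (le_of_eq ?_) rfl rfl
  rw [hb, hK, KB]
  push_cast
  ring

end PartA2
end Z2

namespace Z2
section PartL1
open PowerSeries

noncomputable def xx (t : ℤ) : PowerSeries ℚ := C ((t:ℚ) + 1/4) + X
noncomputable def uu (k : ℕ) (t : ℤ) : PowerSeries ℚ := (C ((t:ℚ) + k + 1/4) + X)⁻¹

noncomputable def RQ (s n : ℕ) (t : ℤ) : PowerSeries ℚ :=
  (4 * xx t - 1) ^ s * ((∏ j ∈ range n, (4 * xx t + C (4 * (j:ℚ) + 3))) * ∏ k ∈ range (n + 1), uu k t) ^ (s + 2)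

lemma quarter_ne (m : ℤ) : (m:ℚ) + 1/4 ≠ 0 := by
  intro h
  have h1 : (4 * m + 1 : ℚ) = 0 := by linarith
  have h2 : (4 * m + 1 : ℤ) = 0 := by exact_mod_cast h1
  omega

lemma quarter_ne' (t : ℤ) (k : ℕ) : (t:ℚ) + k + 1/4 ≠ 0 := by
  have := quarter_ne (t + k)
  push_cast at this
  exact this

lemma xx_mul_uu (k : ℕ) (t : ℤ) : (xx t + C (k:ℚ)) * uu k t = 1 := by
  unfold xx uu
  have : (C ((t:ℚ) + 1/4) + X + C (k:ℚ) : PowerSeries ℚ) = C ((t:ℚ) + k + 1/4) + X := by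
    simp only [map_add]; ring
  rw [this]
  apply PowerSeries.mul_inv_cancel
  simpa using quarter_ne' t k

lemma coeff_inv_pow (c : ℚ) (hc : c ≠ 0) (i h : ℕ) :
    coeff h (((C c + X : PowerSeries ℚ)⁻¹) ^ (i + 1)) = (-1) ^ h * (i + h).choose h * (c⁻¹) ^ (i + 1 + h) := by
  set W : PowerSeries ℚ := C (c⁻¹) ^ (i + 1) * rescale (-c⁻¹) (invOneSubPow ℚ (i + 1)).val with hW
  have h1 : (C c + X : PowerSeries ℚ) = C c * rescale (-c⁻¹) (1 - X) := by
    rw [map_sub, map_one, rescale_X, mul_sub, mul_one, ← mul_assoc, ← map_mul]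
    rw [mul_neg, mul_inv_cancel₀ hc]
    simp
  have h2 : W * (C c + X) ^ (i + 1) = 1 := by
    have h3 : (invOneSubPow ℚ (i + 1)).val * (1 - X) ^ (i + 1) = 1 := by
      rw [← invOneSubPow_inv_eq_one_sub_pow]
      exact (invOneSubPow ℚ (i + 1)).val_inv
    rw [h1, hW, mul_pow, ← map_pow (rescale (-c⁻¹))]
    calc _ = (C c⁻¹ * C c) ^ (i + 1) * (rescale (-c⁻¹) ((invOneSubPow ℚ (i + 1)).val * (1 - X) ^ (i + 1))) := by
          rw [map_mul, mul_pow]; ring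
      _ = 1 := by rw [h3, ← map_mul, inv_mul_cancel₀ hc]; simp
  have h4 : (C c + X : PowerSeries ℚ) * (C c + X)⁻¹ = 1 := PowerSeries.mul_inv_cancel _ (by simpa using hc)
  have h5 : ((C c + X : PowerSeries ℚ)⁻¹) ^ (i + 1) = W := by
    calc _ = (W * (C c + X) ^ (i + 1)) * ((C c + X : PowerSeries ℚ)⁻¹) ^ (i + 1) := by rw [h2, one_mul]
      _ = W * ((C c + X : PowerSeries ℚ) * (C c + X)⁻¹) ^ (i + 1) := by rw [mul_assoc, mul_pow]
      _ = W := by rw [h4]; simp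
  rw [h5, hW, ← map_pow, coeff_C_mul, coeff_rescale, invOneSubPow_val_succ_eq_mk_add_choose, coeff_mk]
  rw [show (i + h).choose i = (i + h).choose h from by rw [Nat.choose_symm_add]]
  rw [neg_pow, pow_add _ (i+1) h]
  ring

lemma coeff_uu_pow (k : ℕ) (t : ℤ) (i h : ℕ) :
    coeff h (uu k t ^ (i + 1)) = (-1) ^ h * (i + h).choose h * (((t:ℚ) + k + 1/4)⁻¹) ^ (i + 1 + h) :=
  coeff_inv_pow _ (quarter_ne' t k) i h

theorem RQ_rep (s n d : ℕ) (hd0 : d ≠ 0) (hd : ∀ k ≤ n, k ≠ 0 → k ∣ d) :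
    ∃ a : ℕ → ℕ → ℚ, (∀ t, RQ s n t = ∑ k ∈ range (n + 1), ∑ i ∈ range (s + 2), a k i • uu k t ^ (i + 1)) ∧
      (∀ k i, ∃ z : ℤ, (2 ^ n) ^ (s + 2) * (d:ℚ) ^ (s + 2) * a k i = d ^ (i + 1) * z) ∧
      ∑ k ∈ range (n + 1), ∑ i ∈ range (s + 2), |a k i| ≤ KB s n ∧ ∑ k ∈ range (n + 1), a k 0 = 0 := by
  obtain ⟨a, h1, h2, h3, h4, h5⟩ := rep_R (A := ℤ → PowerSeries ℚ) s n d hd0 hd xx (fun k t => uu k t) (by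
    intro k _
    funext t
    exact xx_mul_uu k t)
  refine ⟨a, fun t => ?_, h3, h4, h5⟩
  have h6 := congrFun h1 t
  simp only [Finset.sum_apply, Pi.mul_apply, Pi.pow_apply, Pi.smul_apply, Finset.prod_apply, Pi.add_apply, Pi.sub_apply] at h6
  exact h6

lemma RQ_zero (s n j : ℕ) (hj : 1 ≤ j) (hjn : j ≤ n) : coeff (s + 1) (RQ s n (-(j:ℤ))) = 0 := by
  have h1 : (X : PowerSeries ℚ) ^ (s + 2) ∣ RQ s n (-(j:ℤ)) := by
    unfold RQ
    apply Dvd.dvd.mul_left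
    apply pow_dvd_pow_of_dvd
    apply Dvd.dvd.mul_right
    refine Dvd.dvd.trans ?_ (Finset.dvd_prod_of_mem _ (show j - 1 ∈ range n by simp; omega))
    refine ⟨4, ?_⟩
    unfold xx
    have : C (4 * ((j - 1 : ℕ):ℚ) + 3) = (4 * C ((j:ℚ)) - 1 : PowerSeries ℚ) := by
      push_cast [hj]
      simp only [map_add, map_mul, map_sub]
      have : (C (4:ℚ) : PowerSeries ℚ) = 4 := by rfl
      have h3 : (C (3:ℚ) : PowerSeries ℚ) = 3 := by rfl
      simp [this, h3]; ring
    rw [this]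
    push_cast
    have h4 : (4 * C (1/4:ℚ) : PowerSeries ℚ) = 1 := by
      have : (C (4:ℚ) : PowerSeries ℚ) = 4 := by rfl
      rw [← this, ← map_mul]; norm_num
    simp only [map_add, map_neg]
    linear_combination h4
  rw [X_pow_dvd_iff] at h1
  exact h1 _ (by omega)

end PartL1
end Z2

namespace Z2
section PartL2

/-- the subring of integers in the rationals -/
def ZQ : Subring ℚ := (Int.castRingHom ℚ).range

lemma mem_ZQ {q : ℚ} : q ∈ ZQ ↔ ∃ z : ℤ, q = z := by
  simp [ZQ, eq_comm]

lemma int_mem_ZQ (z : ℤ) : (z:ℚ) ∈ ZQ := mem_ZQ.2 ⟨z, rfl⟩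
lemma nat_mem_ZQ (z : ℕ) : (z:ℚ) ∈ ZQ := mem_ZQ.2 ⟨z, by simp⟩

lemma int_of_sum_zero (S : Finset ℕ) (V : ℕ → ℚ) (om : ℕ → ℕ)
    (hc : ∀ k ∈ S, ∀ l ∈ S, k ≠ l → Nat.Coprime (om k) (om l))
    (hV : ∀ k ∈ S, V k * om k ∈ ZQ) (h0 : ∑ k ∈ S, V k = 0) : ∀ k ∈ S, V k ∈ ZQ := by
  intro k hk
  set P : ℕ := ∏ l ∈ S.erase k, om l with hP
  have hcop : Nat.Coprime (om k) P := by
    apply Nat.Coprime.prod_right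
    intro l hl
    rw [Finset.mem_erase] at hl
    exact hc k hk l hl.2 (Ne.symm hl.1)
  have h1 : V k * P ∈ ZQ := by
    rw [← Finset.add_sum_erase _ _ hk] at h0
    have : V k = - ∑ l ∈ S.erase k, V l := by linarith
    rw [this, neg_mul, Finset.sum_mul]
    apply neg_mem
    apply Subring.sum_mem
    intro l hl
    rw [hP, ← Finset.mul_prod_erase _ _ hl]
    push_cast
    rw [← mul_assoc]
    apply mul_mem (hV l (Finset.mem_of_mem_erase hl))
    exact_mod_cast nat_mem_ZQ _
  have hb : (1:ℤ) = om k * Nat.gcdA (om k) P + P * Nat.gcdB (om k) P := by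
    have := Nat.gcd_eq_gcd_ab (om k) P
    rw [hcop] at this
    exact_mod_cast this
  have hb' : (1:ℚ) = om k * Nat.gcdA (om k) P + P * Nat.gcdB (om k) P := by exact_mod_cast hb
  have : V k = (V k * om k) * Nat.gcdA (om k) P + (V k * P) * Nat.gcdB (om k) P := by
    linear_combination V k * hb'
  rw [this]
  exact add_mem (mul_mem (hV k hk) (int_mem_ZQ _)) (mul_mem h1 (int_mem_ZQ _))

/-- the denominator -/
def DD (n m : ℕ) : ℕ := Nat.lcmUpto n * primorial m ^ 2

lemma DD_ne (n m : ℕ) : DD n m ≠ 0 :=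
  mul_ne_zero (Nat.lcmUpto_ne_zero n) (pow_ne_zero _ (primorial_ne_zero m))

lemma dvd_lcm' {n k : ℕ} (h : k ≤ n) (h0 : k ≠ 0) : k ∣ Nat.lcmUpto n := by
  unfold Nat.lcmUpto
  exact Finset.dvd_lcm (f := id) (by simp; omega)

lemma omega_prime {n m w p : ℕ} (hm : 4 * n + 1 ≤ m ^ 2) (hw : w % 2 = 1) (hwn : w ≤ 4 * n + 1)
    (hp : p.Prime) (hpw : p ∣ w / Nat.gcd w (DD n m)) : n < p ∧ p ≠ 2 := by
  have hgw : Nat.gcd w (DD n m) * (w / Nat.gcd w (DD n m)) = w := Nat.mul_div_cancel' (Nat.gcd_dvd_left _ _)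
  have hp2 : p ≠ 2 := by
    rintro rfl
    have : 2 ∣ w := by rw [← hgw]; exact hpw.mul_left _
    omega
  refine ⟨?_, hp2⟩
  by_contra hle
  push Not at hle
  have hp3 : 3 ≤ p := by
    have := hp.two_le
    omega
  have hw0 : w ≠ 0 := by rintro rfl; simp at hw
  set a := w.factorization p with ha
  have h1 : p ^ a ∣ w := Nat.ordProj_dvd w p
  have h2 : ¬ p ^ (a + 1) ∣ w := Nat.pow_succ_factorization_not_dvd hw0 hp
  have hpa : p ^ a ≤ 4 * n + 1 := (Nat.le_of_dvd (Nat.pos_of_ne_zero hw0) h1).trans hwn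
  have hn0 : n ≠ 0 := by have := hp.pos; omega
  have key : p ^ a ∣ DD n m := by
    set a0 := Nat.log p n with ha0
    have h3 : p ^ a0 ∣ Nat.lcmUpto n := dvd_lcm' (Nat.pow_log_le_self p hn0) (pow_ne_zero _ hp.ne_zero)
    have h4 : n < p ^ (a0 + 1) := Nat.lt_pow_succ_log_self hp.one_lt n
    have ha1 : 1 ≤ a0 := by
      rw [ha0]; exact Nat.log_pos hp.one_lt hle
    by_cases hc : a ≤ a0
    · exact ((pow_dvd_pow p hc).trans h3).mul_right _
    · have h5 : a ≤ a0 + 2 := by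
        by_contra h6
        push Not at h6
        have h7 : p ^ (a0 + 3) ≤ p ^ a := Nat.pow_le_pow_right hp.pos h6
        have h8 : p ^ (a0 + 3) = p ^ (a0 + 1) * (p * p) := by ring
        have h9 : 3 * 3 ≤ p * p := Nat.mul_le_mul hp3 hp3
        nlinarith
      have h6 : p ≤ m := by
        have h7 : p ^ 2 ≤ p ^ a := Nat.pow_le_pow_right hp.pos (by omega)
        have h8 : p ^ 2 ≤ m ^ 2 := by omega
        exact (Nat.pow_le_pow_iff_left (by norm_num)).1 h8
      have h7 : p ^ 2 ∣ primorial m ^ 2 := pow_dvd_pow_of_dvd (hp.dvd_primorial_iff.2 h6) 2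
      refine (pow_dvd_pow p h5).trans ?_
      rw [pow_add]
      exact mul_dvd_mul h3 h7
  apply h2
  rw [pow_succ, ← hgw]
  exact mul_dvd_mul (Nat.dvd_gcd h1 key) hpw

def ww (j k : ℕ) : ℕ := (4 * ((k:ℤ) - j) + 1).natAbs

lemma ww_cop {n m j k l : ℕ} (hm : 4 * n + 1 ≤ m ^ 2) (hj : j ≤ n) (hk : k ≤ n) (hl : l ≤ n)
    (hkl : k ≠ l) :
    Nat.Coprime (ww j k / Nat.gcd (ww j k) (DD n m)) (ww j l / Nat.gcd (ww j l) (DD n m)) := by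
  apply Nat.Coprime.symm
  rw [Nat.coprime_iff_gcd_eq_one]
  by_contra hg
  obtain ⟨p, hp, hpd⟩ := Nat.exists_prime_and_dvd hg
  have h1 := hpd.trans (Nat.gcd_dvd_left _ _)
  have h2 := hpd.trans (Nat.gcd_dvd_right _ _)
  have h3 := omega_prime hm (by unfold ww; omega) (by unfold ww; omega) hp h1
  have h4 : p ∣ ww j l := h1.trans (Nat.div_dvd_of_dvd (Nat.gcd_dvd_left _ _))
  have h5 : p ∣ ww j k := h2.trans (Nat.div_dvd_of_dvd (Nat.gcd_dvd_left _ _))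
  unfold ww at h4 h5
  rw [← Int.natCast_dvd] at h4 h5
  have h6 : (p:ℤ) ∣ 4 * ((k:ℤ) - l) := by
    have h := dvd_sub h5 h4
    have e : (4 * ((k:ℤ) - j) + 1) - (4 * ((l:ℤ) - j) + 1) = 4 * ((k:ℤ) - l) := by ring
    rwa [e] at h
  have hp' : Prime (p:ℤ) := Nat.prime_iff_prime_int.1 hp
  rcases hp'.dvd_or_dvd h6 with h7 | h7
  · have h8 : p ∣ 2 ^ 2 := by exact_mod_cast h7
    have := (Nat.prime_dvd_prime_iff_eq hp Nat.prime_two).1 (hp.dvd_of_dvd_pow h8)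
    exact h3.2 this
  · have := Int.le_of_dvd (a := p) (b := |(k:ℤ) - l|) (by rw [abs_pos]; omega) ((dvd_abs _ _).2 h7)
    have h9 : |(k:ℤ) - l| ≤ n := by rw [abs_le]; omega
    omega

/-- the coefficient at `s+1` -/
def PP (s : ℕ) (a : ℕ → ℕ → ℚ) (k : ℕ) (t : ℤ) : ℚ :=
  ∑ i ∈ range (s + 2), a k i * ((-1) ^ (s + 1) * (i + (s + 1)).choose (s + 1) * (((t:ℚ) + k + 1/4)⁻¹) ^ (i + 1 + (s + 1)))

lemma PP_om (s n m : ℕ) (a : ℕ → ℕ → ℚ)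
    (ha : ∀ k i, ∃ z : ℤ, (2 ^ n) ^ (s + 2) * (Nat.lcmUpto n:ℚ) ^ (s + 2) * a k i = Nat.lcmUpto n ^ (i + 1) * z)
    (j k : ℕ) :
    (2 ^ n) ^ (s + 2) * (DD n m : ℚ) ^ (2 * s + 3) * PP s a k (-(j:ℤ)) *
      ((ww j k / Nat.gcd (ww j k) (DD n m)) ^ (2 * s + 3) : ℕ) ∈ ZQ := by
  unfold PP
  set α := Nat.gcd (ww j k) (DD n m)
  set om := ww j k / α with hom
  rw [Finset.mul_sum, Finset.sum_mul]
  apply Subring.sum_mem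
  intro i hi
  rw [Finset.mem_range] at hi
  obtain ⟨l, hl⟩ : ∃ l, s + 1 = i + l := ⟨s + 1 - i, by omega⟩
  have hd0 : (Nat.lcmUpto n : ℚ) ≠ 0 := by exact_mod_cast Nat.lcmUpto_ne_zero n
  -- first factor
  have F1 : (2 ^ n) ^ (s + 2) * (DD n m : ℚ) ^ l * a k i ∈ ZQ := by
    obtain ⟨z, hz⟩ := ha k i
    have h1 : (2 ^ n) ^ (s + 2) * (Nat.lcmUpto n:ℚ) ^ l * a k i = z := by
      have h2 : (Nat.lcmUpto n:ℚ) ^ (s + 2) = Nat.lcmUpto n ^ (i + 1) * Nat.lcmUpto n ^ l := by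
        rw [← pow_add]; congr 1; omega
      rw [h2] at hz
      have h3 : (Nat.lcmUpto n:ℚ) ^ (i + 1) ≠ 0 := pow_ne_zero _ hd0
      apply mul_left_cancel₀ h3
      linear_combination hz
    have h4 : (2 ^ n) ^ (s + 2) * (DD n m : ℚ) ^ l * a k i = z * ((primorial m ^ 2) ^ l : ℕ) := by
      rw [← h1]; unfold DD; push_cast; rw [mul_pow]; ring
    rw [h4]
    exact mul_mem (int_mem_ZQ _) (nat_mem_ZQ _)
  -- second factor
  have F2 : (DD n m : ℚ) * ((((-(j:ℤ) : ℤ):ℚ) + k + 1/4)⁻¹) * om ∈ ZQ := by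
    have hα : α ∣ DD n m := Nat.gcd_dvd_right _ _
    have hα' : α ∣ ww j k := Nat.gcd_dvd_left _ _
    obtain ⟨y, hy⟩ := hα
    have hα0 : α ≠ 0 := by
      intro h; rw [h] at hy; exact DD_ne n m (by simpa using hy)
    have hw : ww j k = α * om := by rw [hom, Nat.mul_div_cancel' hα']
    have hw1 : (ww j k : ℤ) = 4 * ((k:ℤ) - j) + 1 ∨ (ww j k : ℤ) = -(4 * ((k:ℤ) - j) + 1) := by
      unfold ww; omega
    have hne := quarter_ne' (-(j:ℤ)) k
    set c : ℚ := (((-(j:ℤ) : ℤ):ℚ) + k + 1/4) with hcdef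
    have hw2 : (α * om : ℚ) = 4 * c ∨ (α * om : ℚ) = -(4 * c) := by
      rw [hw] at hw1
      rcases hw1 with h | h
      · left
        have : ((α * om : ℕ) : ℚ) = 4 * ((k:ℚ) - j) + 1 := by exact_mod_cast h
        push_cast at this
        rw [this, hcdef]; push_cast; ring
      · right
        have : ((α * om : ℕ) : ℚ) = -(4 * ((k:ℚ) - j) + 1) := by exact_mod_cast h
        push_cast at this
        rw [this, hcdef]; push_cast; ring
    rw [hy]
    push_cast
    rcases hw2 with h | h
    · have : (α * y : ℚ) * c⁻¹ * om = (4 * y : ℕ) := by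
        rw [show (α * y : ℚ) * c⁻¹ * om = (α * om) * y * c⁻¹ by ring, h]
        push_cast
        field_simp
      rw [this]; exact nat_mem_ZQ _
    · have : (α * y : ℚ) * c⁻¹ * om = -(4 * y : ℕ) := by
        rw [show (α * y : ℚ) * c⁻¹ * om = (α * om) * y * c⁻¹ by ring, h]
        push_cast
        field_simp
      rw [this]; exact neg_mem (nat_mem_ZQ _)
  set c : ℚ := (((-(j:ℤ) : ℤ):ℚ) + k + 1/4) with hcdef
  have e1 : 2 * s + 3 = l + (i + 1 + (s + 1)) := by omega
  have : (2 ^ n) ^ (s + 2) * (DD n m : ℚ) ^ (2 * s + 3) *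
      (a k i * ((-1) ^ (s + 1) * (i + (s + 1)).choose (s + 1) * (c⁻¹) ^ (i + 1 + (s + 1)))) * ((om ^ (2 * s + 3) : ℕ) : ℚ)
      = ((2 ^ n) ^ (s + 2) * (DD n m : ℚ) ^ l * a k i) * (((-1) ^ (s + 1) : ℤ) : ℚ) * (((i + (s + 1)).choose (s + 1) : ℕ) : ℚ) *
        ((DD n m : ℚ) * c⁻¹ * om) ^ (i + 1 + (s + 1)) * ((om ^ l : ℕ) : ℚ) := by
    push_cast
    rw [e1, pow_add (DD n m : ℚ), pow_add (om : ℚ), mul_pow, mul_pow]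
    ring
  rw [this]
  exact mul_mem (mul_mem (mul_mem (mul_mem F1 (int_mem_ZQ _)) (nat_mem_ZQ _)) (pow_mem F2 _)) (nat_mem_ZQ _)

lemma PP_int (s n m : ℕ) (hm : 4 * n + 1 ≤ m ^ 2) (a : ℕ → ℕ → ℚ)
    (hR : ∀ t, RQ s n t = ∑ k ∈ range (n + 1), ∑ i ∈ range (s + 2), a k i • uu k t ^ (i + 1))
    (ha : ∀ k i, ∃ z : ℤ, (2 ^ n) ^ (s + 2) * (Nat.lcmUpto n:ℚ) ^ (s + 2) * a k i = Nat.lcmUpto n ^ (i + 1) * z)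
    (j k : ℕ) (hj : 1 ≤ j) (hjn : j ≤ n) (hk : k ≤ n) :
    (2 ^ n) ^ (s + 2) * (DD n m : ℚ) ^ (2 * s + 3) * PP s a k (-(j:ℤ)) ∈ ZQ := by
  have h0 : ∑ k ∈ range (n + 1), PP s a k (-(j:ℤ)) = 0 := by
    rw [← RQ_zero s n j hj hjn, hR, map_sum]
    refine Finset.sum_congr rfl fun k _ => ?_
    rw [map_sum]
    refine Finset.sum_congr rfl fun i _ => ?_
    rw [PowerSeries.coeff_smul, coeff_uu_pow]
    simp
  refine int_of_sum_zero (range (n + 1)) (fun k => (2 ^ n) ^ (s + 2) * (DD n m : ℚ) ^ (2 * s + 3) * PP s a k (-(j:ℤ)))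
    (fun k => (ww j k / Nat.gcd (ww j k) (DD n m)) ^ (2 * s + 3)) ?_ ?_ ?_ k (by simp; omega)
  · intro k hk l hl hkl
    simp only [Finset.mem_range] at hk hl
    exact (ww_cop hm hjn (by omega) (by omega) hkl).pow _ _
  · intro k _
    exact PP_om s n m a ha j k
  · rw [← Finset.mul_sum, h0, mul_zero]

end PartL2
end Z2

namespace Z2
section PartL3

/-- normalised sums -/
noncomputable def SM (f : ℕ → ℚ) (M : ℕ) : ℚ_[2] := (2 ^ M : ℚ_[2])⁻¹ * ∑ t ∈ range (2 ^ M), ((f t : ℚ) : ℚ_[2])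

lemma SM_add (f g : ℕ → ℚ) (M : ℕ) : SM (fun t => f t + g t) M = SM f M + SM g M := by
  unfold SM
  rw [← mul_add, ← Finset.sum_add_distrib]
  push_cast
  rfl

lemma SM_smul (c : ℚ) (f : ℕ → ℚ) (M : ℕ) : SM (fun t => c * f t) M = c * SM f M := by
  unfold SM
  push_cast
  rw [← Finset.mul_sum]
  ring

lemma SM_sum {ι : Type*} (S : Finset ι) (f : ι → ℕ → ℚ) (M : ℕ) :
    SM (fun t => ∑ i ∈ S, f i t) M = ∑ i ∈ S, SM (f i) M := by
  unfold SM
  push_cast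
  rw [Finset.sum_comm, Finset.mul_sum]

lemma two_pow_tendsto : Tendsto (fun M : ℕ => (2:ℚ_[2]) ^ M) atTop (nhdsWithin 0 {0}ᶜ) := by
  rw [tendsto_nhdsWithin_iff]
  constructor
  · apply tendsto_pow_atTop_nhds_zero_of_norm_lt_one
    have := Padic.norm_p (p := 2)
    have h2 : ((2:ℕ):ℚ_[2]) = 2 := by norm_num
    rw [h2] at this
    rw [this]; norm_num
  · exact Filter.Eventually.of_forall fun M => by simp

lemma sum_shift {G : Type*} [AddCommGroup G] (f : ℕ → G) (N k : ℕ) :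
    ∑ t ∈ range N, f (t + k) - ∑ t ∈ range N, f t = ∑ l ∈ range k, (f (N + l) - f l) := by
  have h1 := Finset.sum_range_add f N k
  have h2 := Finset.sum_range_add f k N
  rw [add_comm k N, h1] at h2
  rw [Finset.sum_sub_distrib]
  have h3 : ∑ t ∈ range N, f (t + k) = ∑ t ∈ range N, f (k + t) := by
    simp only [add_comm]
  rw [h3, sub_eq_sub_iff_add_eq_add, add_comm _ (∑ l ∈ range k, f l), ← h2, add_comm]

lemma quarter_ne2 (l : ℕ) : (l : ℚ_[2]) + 1/4 ≠ 0 := by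
  have := quarter_ne l
  have h2 : (((l:ℤ):ℚ) + 1/4 : ℚ) = ((l:ℚ) + 1/4) := by simp
  rw [h2] at this
  have h3 : (((l:ℚ) + 1/4 : ℚ) : ℚ_[2]) ≠ 0 := by exact_mod_cast this
  push_cast at h3
  exact h3

lemma delta_tendsto (m k : ℕ) :
    Tendsto (fun M => SM (fun t => (((t:ℚ) + k + 1/4)⁻¹) ^ m) M - SM (fun t => (((t:ℚ) + 1/4)⁻¹) ^ m) M) atTop
      (nhds (((-(m:ℚ)) * ∑ l ∈ range k, (((l:ℚ) + 1/4)⁻¹) ^ (m + 1) : ℚ) : ℚ_[2])) := by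
  have key : ∀ l : ℕ, Tendsto (fun M : ℕ => (2 ^ M : ℚ_[2])⁻¹ * ((((((2:ℕ) ^ M + l : ℕ) : ℚ_[2]) + 1/4)⁻¹) ^ m - (((l:ℚ_[2]) + 1/4)⁻¹) ^ m)) atTop
      (nhds ((-(m:ℚ_[2])) * (((l:ℚ_[2]) + 1/4)⁻¹) ^ (m + 1))) := by
    intro l
    have hne := quarter_ne2 l
    have hd : HasDerivAt (fun x : ℚ_[2] => ((x + 1/4)⁻¹) ^ m) ((-(m:ℚ_[2])) * (((l:ℚ_[2]) + 1/4)⁻¹) ^ (m + 1)) (l:ℚ_[2]) := by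
      have h1 : HasDerivAt (fun x : ℚ_[2] => x + 1/4) 1 (l:ℚ_[2]) := (hasDerivAt_id _).add_const _
      have h2 := (h1.inv hne).pow m
      have h3 : (-(m:ℚ_[2])) * (((l:ℚ_[2]) + 1/4)⁻¹) ^ (m + 1) =
          (m:ℚ_[2]) * (((l:ℚ_[2]) + 1/4)⁻¹) ^ (m - 1) * (-1 / ((l:ℚ_[2]) + 1/4) ^ 2) := by
        rcases m with _ | m
        · simp
        · generalize (l:ℚ_[2]) + 1/4 = y
          rw [Nat.add_sub_cancel, div_eq_mul_inv, ← inv_pow]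
          ring
      rw [h3]
      exact h2
    rw [hasDerivAt_iff_tendsto_slope_zero] at hd
    have h3 := hd.comp two_pow_tendsto
    refine h3.congr fun M => ?_
    simp only [Function.comp, smul_eq_mul]
    push_cast
    rw [add_comm (l:ℚ_[2]) (2 ^ M)]
  have h4 := tendsto_finsetSum (range k) (fun l _ => key l)
  have h5 : (((-(m:ℚ)) * ∑ l ∈ range k, (((l:ℚ) + 1/4)⁻¹) ^ (m + 1) : ℚ) : ℚ_[2]) =
      ∑ l ∈ range k, (-(m:ℚ_[2])) * (((l:ℚ_[2]) + 1/4)⁻¹) ^ (m + 1) := by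
    push_cast
    rw [Finset.mul_sum]
  rw [h5]
  refine h4.congr fun M => ?_
  unfold SM
  rw [← mul_sub, ← Finset.mul_sum]
  congr 1
  have := sum_shift (fun t : ℕ => ((((t:ℚ_[2]) + 1/4)⁻¹) ^ m)) (2 ^ M) k
  rw [← this]
  push_cast
  rfl

lemma RQ_coeff (s n : ℕ) (a : ℕ → ℕ → ℚ)
    (hR : ∀ t, RQ s n t = ∑ k ∈ range (n + 1), ∑ i ∈ range (s + 2), a k i • uu k t ^ (i + 1)) (t : ℤ) :
    PowerSeries.coeff s (RQ s n t) = ∑ k ∈ range (n + 1), ∑ i ∈ range (s + 2),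
      (a k i * ((-1) ^ s * (i + s).choose s)) * (((t:ℚ) + k + 1/4)⁻¹) ^ (i + 1 + s) := by
  rw [hR, map_sum]
  refine Finset.sum_congr rfl fun k _ => ?_
  rw [map_sum]
  refine Finset.sum_congr rfl fun i _ => ?_
  rw [PowerSeries.coeff_smul, coeff_uu_pow]
  simp only [smul_eq_mul]
  ring

/-- limit value -/
def LL (s n : ℕ) (a : ℕ → ℕ → ℚ) (q : ℕ → ℚ) : ℚ :=
  ∑ i ∈ range (s + 1), (-1) ^ s * (i + 1 + s).choose s * (∑ k ∈ range (n + 1), a k (i + 1)) * q (i + 2 + s) +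
    (s + 1) * ∑ k ∈ range (n + 1), ∑ l ∈ range k, PP s a k ((l:ℤ) - k)

theorem LL_tendsto (s n : ℕ) (a : ℕ → ℕ → ℚ) (q : ℕ → ℚ)
    (hR : ∀ t, RQ s n t = ∑ k ∈ range (n + 1), ∑ i ∈ range (s + 2), a k i • uu k t ^ (i + 1))
    (h0 : ∑ k ∈ range (n + 1), a k 0 = 0)
    (hq : ∀ m, s + 2 ≤ m → m ≤ 2 * s + 2 → Tendsto (SM (fun t => (((t:ℚ) + 1/4)⁻¹) ^ m)) atTop (nhds ((q m : ℚ) : ℚ_[2]))) :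
    Tendsto (SM (fun t => PowerSeries.coeff s (RQ s n t))) atTop (nhds ((LL s n a q : ℚ) : ℚ_[2])) := by
  set c : ℕ → ℕ → ℚ := fun k i => a k i * ((-1) ^ s * (i + s).choose s) with hc
  have e1 : ∀ M, SM (fun t => PowerSeries.coeff s (RQ s n t)) M =
      (∑ i ∈ range (s + 1), ((∑ k ∈ range (n + 1), c k (i + 1) : ℚ) : ℚ_[2]) * SM (fun t => (((t:ℚ) + 1/4)⁻¹) ^ (i + 2 + s)) M) +
      ∑ k ∈ range (n + 1), ∑ i ∈ range (s + 2), (c k i : ℚ_[2]) *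
        (SM (fun t => (((t:ℚ) + k + 1/4)⁻¹) ^ (i + 1 + s)) M - SM (fun t => (((t:ℚ) + 1/4)⁻¹) ^ (i + 1 + s)) M) := by
    intro M
    have e2 : (fun t : ℕ => PowerSeries.coeff s (RQ s n t)) = fun t : ℕ => ∑ k ∈ range (n + 1), ∑ i ∈ range (s + 2),
        c k i * (((t:ℚ) + k + 1/4)⁻¹) ^ (i + 1 + s) := by
      funext t
      rw [RQ_coeff s n a hR]
      simp [hc]
    rw [e2, SM_sum]
    simp_rw [SM_sum, SM_smul, mul_sub, Finset.sum_sub_distrib]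
    rw [Finset.sum_comm (s := range (n + 1)) (t := range (s + 2)) (f := fun k i => (c k i : ℚ_[2]) * SM (fun t => (((t:ℚ) + 1/4)⁻¹) ^ (i + 1 + s)) M)]
    rw [Finset.sum_range_succ' (fun i => ∑ k ∈ range (n + 1), (c k i : ℚ_[2]) * SM (fun t => (((t:ℚ) + 1/4)⁻¹) ^ (i + 1 + s)) M)]
    have e3 : ∑ k ∈ range (n + 1), (c k 0 : ℚ_[2]) * SM (fun t => (((t:ℚ) + 1/4)⁻¹) ^ (0 + 1 + s)) M = 0 := by
      rw [← Finset.sum_mul]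
      have : ∑ k ∈ range (n + 1), (c k 0 : ℚ_[2]) = ((∑ k ∈ range (n + 1), c k 0 : ℚ) : ℚ_[2]) := by push_cast; rfl
      rw [this, hc]
      simp only
      rw [← Finset.sum_mul, h0]
      simp
    rw [e3]
    have e4 : ∀ i ∈ range (s + 1), ((∑ k ∈ range (n + 1), c k (i + 1) : ℚ) : ℚ_[2]) * SM (fun t => (((t:ℚ) + 1/4)⁻¹) ^ (i + 2 + s)) M =
        ∑ k ∈ range (n + 1), (c k (i + 1) : ℚ_[2]) * SM (fun t => (((t:ℚ) + 1/4)⁻¹) ^ (i + 1 + 1 + s)) M := by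
      intro i _
      push_cast
      rw [Finset.sum_mul]
    rw [Finset.sum_congr rfl e4]
    ring
  have e5 : (LL s n a q : ℚ) = (∑ i ∈ range (s + 1), (∑ k ∈ range (n + 1), c k (i + 1)) * q (i + 2 + s)) +
      ∑ k ∈ range (n + 1), ∑ i ∈ range (s + 2), c k i * ((-((i + 1 + s : ℕ):ℚ)) * ∑ l ∈ range k, (((l:ℚ) + 1/4)⁻¹) ^ (i + 1 + s + 1)) := by
    unfold LL
    congr 1
    · refine Finset.sum_congr rfl fun i _ => ?_
      congr 1
      rw [hc]
      simp only
      rw [← Finset.sum_mul]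
      ring
    · rw [Finset.mul_sum]
      refine Finset.sum_congr rfl fun k _ => ?_
      unfold PP
      rw [Finset.sum_comm, Finset.mul_sum]
      refine Finset.sum_congr rfl fun i _ => ?_
      rw [Finset.mul_sum, Finset.mul_sum, Finset.mul_sum]
      refine Finset.sum_congr rfl fun l _ => ?_
      have e6 : ((((l:ℤ) - k : ℤ) : ℚ) + k + 1/4) = (l:ℚ) + 1/4 := by push_cast; ring
      rw [e6]
      have e7 : ((i + s).choose s * (i + s + 1) : ℚ) = (i + (s + 1)).choose (s + 1) * (s + 1) := by
        have := Nat.add_one_mul_choose_eq (i + s) s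
        have h : ((i + s + 1) * (i + s).choose s : ℚ) = (i + s + 1).choose (s + 1) * (s + 1) := by exact_mod_cast this
        rw [show i + (s + 1) = i + s + 1 by ring]
        linarith
      rw [hc]
      simp only
      push_cast
      have e8 : i + 1 + (s + 1) = i + 1 + s + 1 := by ring
      rw [e8, pow_succ (-1 : ℚ) s]
      linear_combination (a k i) * (-1) ^ s * (((l:ℚ) + 1/4)⁻¹) ^ (i + 1 + s + 1) * e7
  rw [e5]
  refine Tendsto.congr (fun M => (e1 M).symm) ?_
  push_cast
  apply Tendsto.add
  · apply tendsto_finsetSum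
    intro i hi
    rw [Finset.mem_range] at hi
    exact (hq (i + 2 + s) (by omega) (by omega)).const_mul _
  · apply tendsto_finsetSum
    intro k _
    apply tendsto_finsetSum
    intro i _
    have := (delta_tendsto (i + 1 + s) k).const_mul ((c k i : ℚ) : ℚ_[2])
    push_cast at this
    exact this

end PartL3
end Z2

namespace Z2
section PartL4

theorem LL_int (s n m : ℕ) (hm : 4 * n + 1 ≤ m ^ 2) (a : ℕ → ℕ → ℚ) (q : ℕ → ℚ) (q0 : ℕ)
    (hR : ∀ t, RQ s n t = ∑ k ∈ range (n + 1), ∑ i ∈ range (s + 2), a k i • uu k t ^ (i + 1))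
    (ha : ∀ k i, ∃ z : ℤ, (2 ^ n) ^ (s + 2) * (Nat.lcmUpto n:ℚ) ^ (s + 2) * a k i = Nat.lcmUpto n ^ (i + 1) * z)
    (hq : ∀ i, s + 2 ≤ i → i ≤ 2 * s + 2 → q0 * q i ∈ ZQ) :
    q0 * ((2 ^ n) ^ (s + 2) * (DD n m : ℚ) ^ (2 * s + 3)) * LL s n a q ∈ ZQ := by
  set E : ℚ := (2 ^ n) ^ (s + 2) * (DD n m : ℚ) ^ (2 * s + 3) with hE
  have ha' : ∀ k i, E * a k i ∈ ZQ := by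
    intro k i
    obtain ⟨z, hz⟩ := ha k i
    have : E * a k i = ((2 ^ n) ^ (s + 2) * (Nat.lcmUpto n:ℚ) ^ (s + 2) * a k i) *
        ((Nat.lcmUpto n ^ (s + 1) * (primorial m ^ 2) ^ (2 * s + 3) : ℕ) : ℚ) := by
      rw [hE]
      unfold DD
      push_cast
      rw [show 2 * s + 3 = (s + 2) + (s + 1) by ring, mul_pow, pow_add (Nat.lcmUpto n : ℚ)]
      ring
    rw [this, hz]
    refine mul_mem (mul_mem ?_ (int_mem_ZQ _)) (nat_mem_ZQ _)
    exact pow_mem (nat_mem_ZQ _) _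
  unfold LL
  rw [mul_add, Finset.mul_sum]
  apply add_mem
  · apply Subring.sum_mem
    intro i hi
    rw [Finset.mem_range] at hi
    have : (q0:ℚ) * E * ((-1) ^ s * (i + 1 + s).choose s * (∑ k ∈ range (n + 1), a k (i + 1)) * q (i + 2 + s))
        = (((-1) ^ s * (i + 1 + s).choose s : ℤ) : ℚ) * (∑ k ∈ range (n + 1), E * a k (i + 1)) * (q0 * q (i + 2 + s)) := by
      rw [← Finset.mul_sum]
      push_cast
      ring
    rw [this]
    exact mul_mem (mul_mem (int_mem_ZQ _) (Subring.sum_mem _ fun k _ => ha' _ _)) (hq _ (by omega) (by omega))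
  · have : (q0:ℚ) * E * ((s + 1) * ∑ k ∈ range (n + 1), ∑ l ∈ range k, PP s a k ((l:ℤ) - k)) =
        ((q0 * (s + 1) : ℕ) : ℚ) * ∑ k ∈ range (n + 1), ∑ l ∈ range k, E * PP s a k ((l:ℤ) - k) := by
      simp_rw [← Finset.mul_sum]
      push_cast
      ring
    rw [this]
    refine mul_mem (nat_mem_ZQ _) (Subring.sum_mem _ fun k hk => Subring.sum_mem _ fun l hl => ?_)
    rw [Finset.mem_range] at hk hl
    have h2 : ((l:ℤ) - k) = -((k - l : ℕ) : ℤ) := by omega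
    rw [h2]
    exact PP_int s n m hm a hR ha (k - l) k (by omega) (by omega) (by omega)

lemma PP_abs (s : ℕ) (a : ℕ → ℕ → ℚ) (k : ℕ) (t : ℤ) :
    |PP s a k t| ≤ (∑ i ∈ range (s + 2), |a k i|) * (2 ^ (2 * s + 2) * 4 ^ (2 * s + 3)) := by
  unfold PP
  refine (Finset.abs_sum_le_sum_abs _ _).trans ?_
  rw [Finset.sum_mul]
  refine Finset.sum_le_sum fun i hi => ?_
  rw [Finset.mem_range] at hi
  rw [abs_mul, abs_mul, abs_mul, abs_pow, abs_pow, abs_neg, abs_one, one_pow, one_mul]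
  apply mul_le_mul_of_nonneg_left _ (abs_nonneg _)
  apply mul_le_mul
  · rw [Nat.abs_cast]
    have h1 : (i + (s + 1)).choose (s + 1) ≤ 2 ^ (i + (s + 1)) := Nat.choose_le_two_pow _ _
    have h2 : 2 ^ (i + (s + 1)) ≤ 2 ^ (2 * s + 2) := Nat.pow_le_pow_right (by norm_num) (by omega)
    exact_mod_cast h1.trans h2
  · have h1 : |((t:ℚ) + k + 1/4)⁻¹| ≤ 4 := by
      rw [abs_inv]
      have h2 : (1/4:ℚ) ≤ |(t:ℚ) + k + 1/4| := by
        have h3 : (t:ℚ) + k + 1/4 = ((4 * (t + k) + 1 : ℤ) : ℚ) / 4 := by push_cast; ring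
        rw [h3, abs_div]
        have h4 : (1:ℤ) ≤ |4 * (t + k) + 1| := Int.one_le_abs (by omega)
        have h5 : (1:ℚ) ≤ |((4 * (t + k) + 1 : ℤ) : ℚ)| := by exact_mod_cast h4
        rw [abs_of_pos (show (0:ℚ) < 4 by norm_num)]
        linarith
      calc |(t:ℚ) + k + 1/4|⁻¹ ≤ (1/4:ℚ)⁻¹ := inv_anti₀ (by norm_num) h2
        _ = 4 := by norm_num
    calc |((t:ℚ) + k + 1/4)⁻¹| ^ (i + 1 + (s + 1)) ≤ 4 ^ (i + 1 + (s + 1)) := pow_le_pow_left₀ (abs_nonneg _) h1 _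
      _ ≤ 4 ^ (2 * s + 3) := pow_le_pow_right₀ (by norm_num) (by omega)
  · positivity
  · positivity

theorem LL_abs (s n : ℕ) (a : ℕ → ℕ → ℚ) (q : ℕ → ℚ) (Bd Q : ℚ)
    (hB : ∑ k ∈ range (n + 1), ∑ i ∈ range (s + 2), |a k i| ≤ Bd)
    (hq : ∀ i, s + 2 ≤ i → i ≤ 2 * s + 2 → |q i| ≤ Q) :
    |LL s n a q| ≤ (2 ^ (2 * s + 2) * Q + (s + 1) * (n * (2 ^ (2 * s + 2) * 4 ^ (2 * s + 3)))) * Bd := by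
  have hQ : 0 ≤ Q := (abs_nonneg _).trans (hq (s + 2) le_rfl (by omega))
  unfold LL
  refine (abs_add_le _ _).trans ?_
  rw [add_mul (2 ^ (2 * s + 2) * Q)]
  apply add_le_add
  · refine (Finset.abs_sum_le_sum_abs _ _).trans ?_
    calc _ ≤ ∑ i ∈ range (s + 1), (∑ k ∈ range (n + 1), |a k (i + 1)|) * (2 ^ (2 * s + 2) * Q) := by
          refine Finset.sum_le_sum fun i hi => ?_
          rw [Finset.mem_range] at hi
          rw [abs_mul, abs_mul, abs_mul, abs_pow, abs_neg, abs_one, one_pow, one_mul, Nat.abs_cast]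
          have h1 : (i + 1 + s).choose s ≤ 2 ^ (i + 1 + s) := Nat.choose_le_two_pow _ _
          have h2 : 2 ^ (i + 1 + s) ≤ 2 ^ (2 * s + 2) := Nat.pow_le_pow_right (by norm_num) (by omega)
          have h3 : ((i + 1 + s).choose s : ℚ) ≤ 2 ^ (2 * s + 2) := by exact_mod_cast h1.trans h2
          calc _ ≤ 2 ^ (2 * s + 2) * (∑ k ∈ range (n + 1), |a k (i + 1)|) * Q := by
                apply mul_le_mul _ (hq _ (by omega) (by omega)) (abs_nonneg _) (by positivity)
                apply mul_le_mul h3 (Finset.abs_sum_le_sum_abs _ _) (abs_nonneg _) (by positivity)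
            _ = _ := by ring
      _ = (∑ k ∈ range (n + 1), ∑ i ∈ range (s + 1), |a k (i + 1)|) * (2 ^ (2 * s + 2) * Q) := by
          rw [← Finset.sum_mul, Finset.sum_comm]
      _ ≤ Bd * (2 ^ (2 * s + 2) * Q) := by
          apply mul_le_mul_of_nonneg_right _ (by positivity)
          refine le_trans (Finset.sum_le_sum fun k _ => ?_) hB
          rw [Finset.sum_range_succ' _ (s + 1)]
          have := abs_nonneg (a k 0)
          linarith
      _ = _ := by ring
  · rw [abs_mul, abs_of_nonneg (show (0:ℚ) ≤ s + 1 by positivity)]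
    rw [mul_assoc, mul_assoc]
    apply mul_le_mul_of_nonneg_left _ (by positivity)
    set W : ℚ := 2 ^ (2 * s + 2) * 4 ^ (2 * s + 3) with hW
    have hW0 : 0 ≤ W := by positivity
    calc |∑ k ∈ range (n + 1), ∑ l ∈ range k, PP s a k ((l:ℤ) - k)|
        ≤ ∑ k ∈ range (n + 1), n * ((∑ i ∈ range (s + 2), |a k i|) * W) := by
          refine (Finset.abs_sum_le_sum_abs _ _).trans (Finset.sum_le_sum fun k hk => ?_)
          rw [Finset.mem_range] at hk
          refine (Finset.abs_sum_le_sum_abs _ _).trans ?_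
          have h0 : 0 ≤ ∑ i ∈ range (s + 2), |a k i| := Finset.sum_nonneg fun _ _ => abs_nonneg _
          calc _ ≤ ∑ l ∈ range k, ((∑ i ∈ range (s + 2), |a k i|) * W) := Finset.sum_le_sum fun l _ => PP_abs s a k _
            _ = k * ((∑ i ∈ range (s + 2), |a k i|) * W) := by rw [Finset.sum_const, Finset.card_range, nsmul_eq_mul]
            _ ≤ _ := by
              apply mul_le_mul_of_nonneg_right _ (by positivity)
              exact_mod_cast (by omega : k ≤ n)
      _ = n * W * ∑ k ∈ range (n + 1), ∑ i ∈ range (s + 2), |a k i| := by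
          rw [← Finset.mul_sum, ← Finset.sum_mul]; ring
      _ ≤ n * W * Bd := mul_le_mul_of_nonneg_left hB (by positivity)
      _ = _ := by ring

end PartL4
end Z2

namespace Z2
section PartN1
variable {A : Type*} [CommRing A]

/-- divided differences exist -/
def Dv (Φ : ℕ → A) : Prop := ∀ x y : ℕ, ((x:A) - y) ∣ Φ x - Φ y

lemma Dv.const (c : A) : Dv (fun _ => c) := fun x y => by simp
lemma Dv.add {f g : ℕ → A} (hf : Dv f) (hg : Dv g) : Dv (fun t => f t + g t) := fun x y => by
  have := dvd_add (hf x y) (hg x y)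
  convert this using 1; ring
lemma Dv.mul {f g : ℕ → A} (hf : Dv f) (hg : Dv g) : Dv (fun t => f t * g t) := fun x y => by
  have := dvd_add ((hf x y).mul_right (g x)) ((hg x y).mul_left (f y))
  convert this using 1; ring
lemma Dv.cmul (c : A) {g : ℕ → A} (hg : Dv g) : Dv (fun t => c * g t) := (Dv.const c).mul hg
lemma Dv.neg {g : ℕ → A} (hg : Dv g) : Dv (fun t => - g t) := by
  have := hg.cmul (-1)
  simpa using this
lemma Dv.pow {f : ℕ → A} (hf : Dv f) (e : ℕ) : Dv (fun t => f t ^ e) := by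
  induction e with
  | zero => simpa using Dv.const (1:A)
  | succ e ih => simp_rw [pow_succ]; exact ih.mul hf
lemma Dv.prod {ι : Type*} (S : Finset ι) (f : ι → ℕ → A) (hf : ∀ i ∈ S, Dv (f i)) : Dv (fun t => ∏ i ∈ S, f i t) := by
  classical
  induction S using Finset.induction_on with
  | empty => simpa using Dv.const (1:A)
  | insert i S hi ih =>
    simp_rw [Finset.prod_insert hi]
    exact (hf i (by simp)).mul (ih fun j hj => hf j (by simp [hj]))
lemma Dv.sum {ι : Type*} (S : Finset ι) (f : ι → ℕ → A) (hf : ∀ i ∈ S, Dv (f i)) : Dv (fun t => ∑ i ∈ S, f i t) := by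
  classical
  induction S using Finset.induction_on with
  | empty => simpa using Dv.const (0:A)
  | insert i S hi ih =>
    simp_rw [Finset.sum_insert hi]
    exact (hf i (by simp)).add (ih fun j hj => hf j (by simp [hj]))
lemma Dv.inv {f g : ℕ → A} (hf : Dv f) (h : ∀ t, f t * g t = 1) : Dv g := fun x y => by
  have h1 := (hf x y).mul_left (- (g x * g y))
  have : -(g x * g y) * (f x - f y) = g x - g y := by
    linear_combination (- g y) * h x + g x * h y
  rwa [this] at h1

lemma Dv.sum_dvd {f : ℕ → A} (hf : Dv f) (m : ℕ) : (2 ^ m : A) ∣ 2 * ∑ t ∈ range (2 ^ m), f t := by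
  induction m with
  | zero => simp
  | succ m ih =>
    have e1 : (2:ℕ) ^ (m + 1) = 2 ^ m + 2 ^ m := by ring
    rw [e1, Finset.sum_range_add]
    have e2 : ∑ x ∈ range (2 ^ m), f (2 ^ m + x) = ∑ x ∈ range (2 ^ m), f x + ∑ x ∈ range (2 ^ m), (f (2 ^ m + x) - f x) := by
      rw [← Finset.sum_add_distrib]; exact Finset.sum_congr rfl fun x _ => by ring
    rw [e2]
    have h1 : (2 ^ m : A) ∣ ∑ x ∈ range (2 ^ m), (f (2 ^ m + x) - f x) := by
      apply Finset.dvd_sum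
      intro x _
      have := hf (2 ^ m + x) x
      have e : (((2 ^ m + x : ℕ) : A) - x) = 2 ^ m := by push_cast; ring
      rwa [e] at this
    obtain ⟨c, hc⟩ := ih
    obtain ⟨d, hd⟩ := h1
    refine ⟨c + d, ?_⟩
    rw [hd, pow_succ]
    linear_combination 2 * hc

/-- odd constant plus four times a nice function -/
def OP (f : ℕ → A) : Prop := ∃ o : ℕ, o % 2 = 1 ∧ ∃ g : ℕ → A, Dv g ∧ ∀ t, f t = o + 4 * g t

lemma OP.one : OP (fun _ => (1:A)) := ⟨1, rfl, fun _ => 0, Dv.const 0, fun t => by simp⟩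
lemma OP.mul {f g : ℕ → A} (hf : OP f) (hg : OP g) : OP (fun t => f t * g t) := by
  obtain ⟨o, ho, F, hF, h1⟩ := hf
  obtain ⟨p, hp, G, hG, h2⟩ := hg
  refine ⟨o * p, by rw [Nat.mul_mod, ho, hp], fun t => F t * (p + 4 * G t) + o * G t, ?_, fun t => ?_⟩
  · exact (hF.mul ((Dv.const _).add (hG.cmul 4))).add (hG.cmul _)
  · simp only [h1, h2]; push_cast; ring
lemma OP.pow {f : ℕ → A} (hf : OP f) (e : ℕ) : OP (fun t => f t ^ e) := by
  induction e with
  | zero => simpa using OP.one (A := A)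
  | succ e ih => simp_rw [pow_succ]; exact ih.mul hf
lemma OP.prod {ι : Type*} (S : Finset ι) (f : ι → ℕ → A) (hf : ∀ i ∈ S, OP (f i)) : OP (fun t => ∏ i ∈ S, f i t) := by
  classical
  induction S using Finset.induction_on with
  | empty => simpa using OP.one (A := A)
  | insert i S hi ih =>
    simp_rw [Finset.prod_insert hi]
    exact (hf i (by simp)).mul (ih fun j hj => hf j (by simp [hj]))

lemma iv_Dv (hU : ∀ y : A, IsUnit (1 + 4 * y)) {f : ℕ → A} (hf : Dv f) :
    Dv (fun t => Ring.inverse (1 + 4 * f t)) :=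
  Dv.inv ((Dv.const 1).add (hf.cmul 4)) fun _ => Ring.mul_inverse_cancel _ (hU _)

lemma iv_OP (hU : ∀ y : A, IsUnit (1 + 4 * y)) {f : ℕ → A} (hf : Dv f) :
    OP (fun t => Ring.inverse (1 + 4 * f t)) := by
  refine ⟨1, rfl, fun t => - (f t * Ring.inverse (1 + 4 * f t)), (hf.mul (iv_Dv hU hf)).neg, fun t => ?_⟩
  have := Ring.mul_inverse_cancel _ (hU (f t))
  push_cast
  linear_combination this

lemma one_two_pow {f : ℕ → A} (hf : Dv f) (e : ℕ) : ∃ g : ℕ → A, Dv g ∧ ∀ t, (1 + 2 * f t) ^ e = 1 + 2 * e * f t + 4 * g t := by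
  induction e with
  | zero => exact ⟨fun _ => 0, Dv.const 0, fun t => by simp⟩
  | succ e ih =>
    obtain ⟨g, hg, h⟩ := ih
    refine ⟨fun t => e * (f t * f t) + g t * (1 + 2 * f t), ?_, fun t => ?_⟩
    · exact ((hf.mul hf).cmul _).add (hg.mul ((Dv.const 1).add (hf.cmul 2)))
    · rw [pow_succ, h]; push_cast; ring

/-- the basic rational function -/
noncomputable def Qg (s n : ℕ) (y : A) : A :=
  y ^ s * ((∏ j ∈ range n, (y + ((j + 1 : ℕ) : A))) * ∏ k ∈ range (n + 1), Ring.inverse (1 + 4 * (y + (k:A)))) ^ (s + 2)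

/-- valuation of the factorial -/
def Vf (n : ℕ) : ℕ := ∑ j ∈ range n, padicValNat 2 (j + 1)

lemma Vf_eq (n : ℕ) : Vf n = padicValNat 2 n.factorial := by
  induction n with
  | zero => simp [Vf]
  | succ n ih =>
    rw [Vf, Finset.sum_range_succ, ← Vf, ih, Nat.factorial_succ, padicValNat.mul (by omega) (Nat.factorial_ne_zero n), add_comm]

lemma asc_ne (b : ℕ) (hb : b ≠ 0) (n : ℕ) : b.ascFactorial n ≠ 0 := by
  obtain ⟨c, rfl⟩ := Nat.exists_eq_succ_of_ne_zero hb
  exact (Nat.ascFactorial_pos c n).ne'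

lemma asc_val (b : ℕ) (hb : b ≠ 0) (n : ℕ) : ∑ j ∈ range n, padicValNat 2 (b + j) = padicValNat 2 (b.ascFactorial n) := by
  induction n with
  | zero => simp
  | succ n ih =>
    have h1 : b.ascFactorial n ≠ 0 := asc_ne b hb n
    rw [Finset.sum_range_succ, ih, Nat.ascFactorial_succ, padicValNat.mul (by omega) h1, add_comm]

lemma lin {r : ℕ} {xi : ℕ → A} (hxi : Dv xi) {c : ℕ} (hc : c < 2 ^ (r + 1)) (hc0 : c ≠ 0) :
    ∃ g : ℕ → A, Dv g ∧ ∀ t, (c : A) + 2 ^ r * xi t = 2 ^ padicValNat 2 c * g t := by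
  obtain ⟨o, ho⟩ := pow_padicValNat_dvd (p := 2) (n := c)
  have hv : padicValNat 2 c ≤ r := by
    have h1 := Nat.le_of_dvd (Nat.pos_of_ne_zero hc0) (pow_padicValNat_dvd (p := 2) (n := c))
    have h2 := (Nat.pow_lt_pow_iff_right (a := 2) (by norm_num)).1 (h1.trans_lt hc)
    omega
  refine ⟨fun t => o + 2 ^ (r - padicValNat 2 c) * xi t, (Dv.const _).add (hxi.cmul _), fun t => ?_⟩
  have h3 : (2:A) ^ r = 2 ^ padicValNat 2 c * 2 ^ (r - padicValNat 2 c) := by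
    rw [← pow_add]; congr 1; omega
  rw [h3]
  have h4 : (c:A) = 2 ^ padicValNat 2 c * o := by exact_mod_cast congrArg (Nat.cast : ℕ → A) ho
  conv_lhs => rw [h4]
  ring

lemma lin0 {r : ℕ} {xi : ℕ → A} (hxi : Dv xi) {c : ℕ} (hc : c < 2 ^ r) (hc0 : c ≠ 0) :
    ∃ h : ℕ → A, OP h ∧ ∀ t, (c : A) + 2 ^ r * xi t = 2 ^ padicValNat 2 c * h t * (if 2 ^ (r - 1) = c then 1 + 2 * xi t else 1) := by
  by_cases h2 : 2 ^ (r - 1) = c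
  · refine ⟨fun _ => 1, OP.one, fun t => ?_⟩
    have hr : r ≠ 0 := by rintro rfl; simp at hc; omega
    rw [if_pos h2, ← h2, padicValNat.prime_pow]
    obtain ⟨r, rfl⟩ := Nat.exists_eq_succ_of_ne_zero hr
    simp only [Nat.succ_eq_add_one, Nat.add_sub_cancel]
    push_cast
    ring
  · obtain ⟨o, ho⟩ := pow_padicValNat_dvd (p := 2) (n := c)
    have ho2 : o % 2 = 1 := by
      by_contra h
      have h3 : 2 ∣ o := by omega
      obtain ⟨p, rfl⟩ := h3
      have : 2 ^ (padicValNat 2 c + 1) ∣ c := ⟨p, by rw [pow_succ]; rw [mul_assoc]; exact ho⟩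
      exact pow_succ_padicValNat_not_dvd hc0 this
    have hv : padicValNat 2 c + 2 ≤ r := by
      by_contra hlt
      push Not at hlt
      have h1 := Nat.le_of_dvd (Nat.pos_of_ne_zero hc0) (pow_padicValNat_dvd (p := 2) (n := c))
      have h3 := (Nat.pow_lt_pow_iff_right (a := 2) (by norm_num)).1 (h1.trans_lt hc)
      have h4 : padicValNat 2 c = r - 1 := by omega
      rw [h4] at ho
      have h5 : 2 ^ r = 2 ^ (r - 1) * 2 := by rw [← pow_succ]; congr 1; omega
      rw [h5, ho] at hc
      have h6 : o < 2 := lt_of_mul_lt_mul_left hc (Nat.zero_le _)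
      have h7 : o = 1 := by omega
      rw [h7] at ho
      omega
    refine ⟨fun t => o + 4 * (2 ^ (r - 2 - padicValNat 2 c) * xi t), ⟨o, ho2, _, hxi.cmul _, fun t => rfl⟩, fun t => ?_⟩
    rw [if_neg h2]
    have h3 : (2:A) ^ r = 2 ^ padicValNat 2 c * 4 * 2 ^ (r - 2 - padicValNat 2 c) := by
      rw [show (4:A) = 2 ^ 2 by norm_num, ← pow_add, ← pow_add]; congr 1; omega
    rw [h3]
    have h4 : (c:A) = 2 ^ padicValNat 2 c * o := by exact_mod_cast congrArg (Nat.cast : ℕ → A) ho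
    conv_lhs => rw [h4]
    ring

lemma Qg_b (hU : ∀ y : A, IsUnit (1 + 4 * y)) {r n s b : ℕ} (hn : n + 1 = 2 ^ r) {xi : ℕ → A} (hxi : Dv xi) (hb0 : b ≠ 0) (hb : b < 2 ^ r) :
    ∃ g : ℕ → A, Dv g ∧ ∀ t, Qg s n ((b:A) + 2 ^ r * xi t) = 2 ^ (r * s + (s + 2) * Vf n) * (4 * g t) := by
  have e1 : 2 ^ (r + 1) = 2 ^ r + 2 ^ r := by ring
  obtain ⟨g0, hg0, h0⟩ := lin hxi (r := r) (c := b) (by omega) hb0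
  have hj : ∀ j : ℕ, ∃ g : ℕ → A, Dv g ∧ (j ∈ range n → ∀ t, (b + (j + 1) : ℕ) + 2 ^ r * xi t = 2 ^ padicValNat 2 (b + (j + 1)) * g t) := by
    intro j
    by_cases hj : j ∈ range n
    · rw [Finset.mem_range] at hj
      obtain ⟨g, hg, h⟩ := lin hxi (r := r) (c := b + (j + 1)) (by omega) (by omega)
      exact ⟨g, hg, fun _ => h⟩
    · exact ⟨fun _ => 0, Dv.const 0, fun h => absurd h hj⟩
  choose g hg h using hj
  set v := padicValNat 2 b with hv
  set S := ∑ j ∈ range n, padicValNat 2 (b + (j + 1)) with hS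
  have hvr : v + 1 ≤ r := by
    have h1 := Nat.le_of_dvd (Nat.pos_of_ne_zero hb0) (pow_padicValNat_dvd (p := 2) (n := b))
    exact (Nat.pow_lt_pow_iff_right (a := 2) (by norm_num)).1 (h1.trans_lt hb)
  have hSv : r + Vf n ≤ S + v := by
    have h1 := asc_val b hb0 (n + 1)
    rw [Finset.sum_range_succ', add_zero, ← hS, ← hv] at h1
    have h2 : padicValNat 2 ((n + 1).factorial) ≤ padicValNat 2 (b.ascFactorial (n + 1)) := by
      rw [← padicValNat_dvd_iff_le (asc_ne b hb0 _)]
      exact pow_padicValNat_dvd.trans (Nat.factorial_dvd_ascFactorial _ _)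
    rw [← Vf_eq, Vf, Finset.sum_range_succ, ← Vf, show padicValNat 2 (n + 1) = r by rw [hn, padicValNat.prime_pow]] at h2
    omega
  obtain ⟨w, hw⟩ : ∃ w, v * s + S * (s + 2) = r * s + (s + 2) * Vf n + 2 + w := by
    apply Nat.exists_eq_add_of_le
    nlinarith
  refine ⟨fun t => 2 ^ w * (g0 t ^ s * ((∏ j ∈ range n, g j t) * ∏ k ∈ range (n + 1), Ring.inverse (1 + 4 * (((b:A) + 2 ^ r * xi t) + (k:A)))) ^ (s + 2)), ?_, fun t => ?_⟩
  · refine ((hg0.pow s).mul (((Dv.prod _ _ fun j _ => hg j).mul (Dv.prod _ _ fun k _ => iv_Dv hU ?_)).pow (s + 2))).cmul _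
    exact ((Dv.const _).add (hxi.cmul _)).add (Dv.const _)
  · unfold Qg
    have e2 : ∏ j ∈ range n, ((b:A) + 2 ^ r * xi t + ((j + 1 : ℕ) : A)) = 2 ^ S * ∏ j ∈ range n, g j t := by
      rw [hS, ← Finset.prod_pow_eq_pow_sum, ← Finset.prod_mul_distrib]
      refine Finset.prod_congr rfl fun j hj => ?_
      rw [← h j hj t]
      push_cast
      ring
    have e3 : (2:A) ^ (r * s + (s + 2) * Vf n) * 4 * 2 ^ w = (2 ^ v) ^ s * (2 ^ S) ^ (s + 2) := by
      rw [← pow_mul, ← pow_mul, ← pow_add, hw, pow_add _ _ w, pow_add _ _ 2]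
      norm_num
    rw [e2]
    simp only
    generalize ∏ k ∈ range (n + 1), Ring.inverse (1 + 4 * (((b:A) + 2 ^ r * xi t) + (k:A))) = B
    rw [h0 t, mul_pow ((2:A) ^ v), mul_assoc (2 ^ S : A), mul_pow (2 ^ S : A)]
    linear_combination (-(g0 t ^ s * ((∏ j ∈ range n, g j t) * B) ^ (s + 2))) * e3

lemma Qg_0 (hU : ∀ y : A, IsUnit (1 + 4 * y)) {r n s : ℕ} (hn : n + 1 = 2 ^ r) (hr : 1 ≤ r) {xi : ℕ → A} (hxi : Dv xi) :
    ∃ o : ℕ, o % 2 = 1 ∧ ∃ g : ℕ → A, Dv g ∧ ∀ t, Qg s n (((0:ℕ):A) + 2 ^ r * xi t) =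
      2 ^ (r * s + (s + 2) * Vf n) * (o * (xi t ^ s * (1 + 2 * (s + 2 : ℕ) * xi t)) + 4 * g t) := by
  have hj : ∀ j : ℕ, ∃ h : ℕ → A, OP h ∧ (j ∈ range n → ∀ t, ((j + 1 : ℕ) : A) + 2 ^ r * xi t =
      2 ^ padicValNat 2 (j + 1) * h t * (if 2 ^ (r - 1) - 1 = j then 1 + 2 * xi t else 1)) := by
    intro j
    by_cases hj : j ∈ range n
    · rw [Finset.mem_range] at hj
      obtain ⟨g, hg, h⟩ := lin0 hxi (r := r) (c := j + 1) (by omega) (by omega)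
      refine ⟨g, hg, fun _ t => ?_⟩
      rw [h t]
      congr 1
      have : 0 < 2 ^ (r - 1) := by positivity
      exact if_congr (by omega) rfl rfl
    · exact ⟨fun _ => 1, OP.one, fun h => absurd h hj⟩
  choose h hOP hh using hj
  have hmem : 2 ^ (r - 1) - 1 ∈ range n := by
    rw [Finset.mem_range]
    have h1 : 2 ^ r = 2 ^ (r - 1) * 2 := by rw [← pow_succ]; congr 1; omega
    have : 0 < 2 ^ (r - 1) := by positivity
    omega
  have e2 : ∀ t, ∏ j ∈ range n, (((0:ℕ):A) + 2 ^ r * xi t + ((j + 1 : ℕ) : A)) = 2 ^ Vf n * (∏ j ∈ range n, h j t) * (1 + 2 * xi t) := by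
    intro t
    rw [Vf, ← Finset.prod_pow_eq_pow_sum, ← Finset.prod_mul_distrib]
    have e3 : (1 + 2 * xi t) = ∏ j ∈ range n, (if 2 ^ (r - 1) - 1 = j then 1 + 2 * xi t else 1) := by
      rw [Finset.prod_ite_eq, if_pos hmem]
    conv_rhs => rw [e3]
    rw [← Finset.prod_mul_distrib]
    refine Finset.prod_congr rfl fun j hj => ?_
    rw [← hh j hj t]
    push_cast
    ring
  obtain ⟨o, ho, g1, hg1, h1⟩ := ((OP.prod (range n) h fun j _ => hOP j).mul
    (OP.prod (range (n + 1)) (fun k t => Ring.inverse (1 + 4 * (((0:ℕ):A) + 2 ^ r * xi t + (k:A))))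
      (fun k _ => iv_OP hU (((Dv.const _).add (hxi.cmul _)).add (Dv.const _))))).pow (s + 2)
  obtain ⟨g2, hg2, h2⟩ := one_two_pow hxi (s + 2)
  refine ⟨o, ho, fun t => xi t ^ s * (g1 t * (1 + 2 * (s + 2 : ℕ) * xi t + 4 * g2 t) + o * g2 t), ?_, fun t => ?_⟩
  · refine (hxi.pow s).mul ((hg1.mul ?_).add (hg2.cmul _))
    exact ((Dv.const _).add (hxi.cmul _)).add (hg2.cmul _)
  · unfold Qg
    rw [e2]
    have h1t := h1 t
    simp only at h1t
    have h2t := h2 t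
    set B := ∏ k ∈ range (n + 1), Ring.inverse (1 + 4 * (((0:ℕ):A) + 2 ^ r * xi t + (k:A))) with hB
    set H := ∏ j ∈ range n, h j t with hH
    have : ((0:ℕ):A) + 2 ^ r * xi t = 2 ^ r * xi t := by simp
    rw [this]
    calc (2 ^ r * xi t) ^ s * (2 ^ Vf n * H * (1 + 2 * xi t) * B) ^ (s + 2)
        = ((2:A) ^ (r * s + (s + 2) * Vf n)) * (xi t ^ s * ((H * B) ^ (s + 2) * (1 + 2 * xi t) ^ (s + 2))) := by
          rw [pow_add _ (r * s), pow_mul _ r, mul_comm (s + 2) (Vf n), pow_mul _ (Vf n)]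
          simp only [mul_pow]
          ring
      _ = _ := by rw [h1t, h2t]; simp only; ring

end PartN1
end Z2

namespace Z2
section PartN2
open PowerSeries

lemma two_not_unit : ¬ IsUnit (2 : ℤ_[2]) := by
  have := (PadicInt.prime_p (p := 2)).not_isUnit
  exact_mod_cast this

lemma unit_one_add_two (y : ℤ_[2]) : IsUnit (1 + 2 * y) := by
  have h : (1 + 2 * y) + (-(2 * y)) = 1 := by ring
  rcases IsLocalRing.isUnit_or_isUnit_of_add_one h with h1 | h1
  · exact h1
  · exfalso
    rw [IsUnit.neg_iff] at h1
    exact two_not_unit (isUnit_of_mul_isUnit_left h1)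

lemma unit_one_add_four (y : ℤ_[2]) : IsUnit (1 + 4 * y) := by
  have := unit_one_add_two (2 * y)
  convert this using 1
  ring

lemma unit_PS (y : PowerSeries ℤ_[2]) : IsUnit (1 + 4 * y) := by
  rw [PowerSeries.isUnit_iff_constantCoeff]
  have : constantCoeff (1 + 4 * y) = 1 + 4 * constantCoeff y := by
    simp only [map_add, map_mul, map_one]
    congr 2
  rw [this]
  exact unit_one_add_four _

lemma sum_range_mul' {G : Type*} [AddCommMonoid G] (f : ℕ → G) (N m : ℕ) :
    ∑ t ∈ range (N * m), f t = ∑ b ∈ range N, ∑ τ ∈ range m, f (b + N * τ) := by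
  rw [Finset.sum_comm]
  induction m with
  | zero => simp
  | succ m ih =>
    rw [Nat.mul_succ, Finset.sum_range_add, ih, Finset.sum_range_succ]
    congr 1
    exact Finset.sum_congr rfl fun b _ => by rw [add_comm]

lemma xi_Dv : Dv (fun τ : ℕ => (τ : PowerSeries ℤ_[2]) + X) := fun x y => by simp

lemma coeff_xi (τ s : ℕ) : coeff (R := ℤ_[2]) s (((τ : PowerSeries ℤ_[2]) + X) ^ s) = 1 ∧
    coeff (R := ℤ_[2]) s (((τ : PowerSeries ℤ_[2]) + X) ^ (s + 1)) = (s + 1) * τ := by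
  have h : ∀ k, ((τ : PowerSeries ℤ_[2]) + X) ^ k = (((Polynomial.X + Polynomial.C (τ : ℤ_[2])) ^ k : Polynomial ℤ_[2]) : PowerSeries ℤ_[2]) := by
    intro k
    rw [Polynomial.coe_pow, Polynomial.coe_add, Polynomial.coe_X, Polynomial.coe_C, add_comm]
    simp
  rw [h, h, Polynomial.coeff_coe, Polynomial.coeff_coe, Polynomial.coeff_X_add_C_pow, Polynomial.coeff_X_add_C_pow]
  constructor
  · simp
  · simp; ring

theorem Qsum {r n s : ℕ} (hn : n + 1 = 2 ^ r) (hr : 1 ≤ r) (m : ℕ) :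
    ∃ u : ℤ_[2], IsUnit u ∧ ∑ t ∈ range (2 ^ (r + m)), coeff s (Qg s n ((t : PowerSeries ℤ_[2]) + 2 ^ r * X)) =
      2 ^ (r * s + (s + 2) * Vf n) * 2 ^ m * u := by
  set xi : ℕ → PowerSeries ℤ_[2] := fun τ : ℕ => (τ : PowerSeries ℤ_[2]) + X with hxidef
  have hxi : Dv xi := xi_Dv
  obtain ⟨o, ho, g0, hg0, h0⟩ := Qg_0 unit_PS (s := s) hn hr hxi
  have hb : ∀ b : ℕ, ∃ g : ℕ → PowerSeries ℤ_[2], Dv g ∧ (b ∈ range (2 ^ r) → ∀ t,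
      Qg s n ((b : PowerSeries ℤ_[2]) + 2 ^ r * xi t) = 2 ^ (r * s + (s + 2) * Vf n) *
        ((if b = 0 then o * (xi t ^ s * (1 + 2 * (s + 2 : ℕ) * xi t)) else 0) + 4 * g t)) := by
    intro b
    by_cases hbr : b ∈ range (2 ^ r)
    · rw [Finset.mem_range] at hbr
      by_cases hb0 : b = 0
      · subst hb0
        exact ⟨g0, hg0, fun _ t => by rw [h0 t, if_pos rfl]⟩
      · obtain ⟨g, hg, h⟩ := Qg_b unit_PS (s := s) hn hxi hb0 hbr
        exact ⟨g, hg, fun _ t => by rw [h t, if_neg hb0, zero_add]⟩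
    · exact ⟨fun _ => 0, Dv.const 0, fun h => absurd h hbr⟩
  choose g hg h using hb
  have hG : ∀ b, ∃ G : PowerSeries ℤ_[2], 2 * ∑ τ ∈ range (2 ^ m), g b τ = 2 ^ m * G := fun b => (hg b).sum_dvd m
  choose G hGe using hG
  have e1 : ∑ t ∈ range (2 ^ (r + m)), Qg s n ((t : PowerSeries ℤ_[2]) + 2 ^ r * X) =
      2 ^ (r * s + (s + 2) * Vf n) * ((o * ∑ τ ∈ range (2 ^ m), (xi τ ^ s * (1 + 2 * (s + 2 : ℕ) * xi τ))) +
        2 * 2 ^ m * ∑ b ∈ range (2 ^ r), G b) := by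
    rw [pow_add, sum_range_mul']
    have e2 : ∀ b ∈ range (2 ^ r), ∑ τ ∈ range (2 ^ m), Qg s n (((b + 2 ^ r * τ : ℕ) : PowerSeries ℤ_[2]) + 2 ^ r * X) =
        2 ^ (r * s + (s + 2) * Vf n) * ((if b = 0 then o * ∑ τ ∈ range (2 ^ m), (xi τ ^ s * (1 + 2 * (s + 2 : ℕ) * xi τ)) else 0) + 2 * 2 ^ m * G b) := by
      intro b hb
      have e3 : ∀ τ ∈ range (2 ^ m), Qg s n (((b + 2 ^ r * τ : ℕ) : PowerSeries ℤ_[2]) + 2 ^ r * X) = 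
          2 ^ (r * s + (s + 2) * Vf n) * ((if b = 0 then o * (xi τ ^ s * (1 + 2 * (s + 2 : ℕ) * xi τ)) else 0) + 4 * g b τ) := by
        intro τ _
        rw [← h b hb τ]
        congr 1
        rw [hxidef]
        push_cast
        ring
      rw [Finset.sum_congr rfl e3, ← Finset.mul_sum, Finset.sum_add_distrib, ← Finset.mul_sum]
      congr 2
      · split_ifs
        · rw [Finset.mul_sum]
        · simp
      · linear_combination 2 * hGe b
    rw [Finset.sum_congr rfl e2, ← Finset.mul_sum, Finset.sum_add_distrib, ← Finset.mul_sum, Finset.sum_ite_eq' , if_pos (by simp)]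
  have e4 := congrArg (coeff s) e1
  rw [map_sum] at e4
  have cz : ∀ (N : ℕ) (f : PowerSeries ℤ_[2]), coeff s ((N : PowerSeries ℤ_[2]) * f) = N * coeff s f := by
    intro N f
    have : (N : PowerSeries ℤ_[2]) = C (N : ℤ_[2]) := by simp
    rw [this, coeff_C_mul]
  have ctau : coeff (R := ℤ_[2]) s (∑ τ ∈ range (2 ^ m), (xi τ ^ s * (1 + 2 * ((s + 2 : ℕ) : PowerSeries ℤ_[2]) * xi τ))) =
      ∑ τ ∈ range (2 ^ m), (1 + 2 * (s + 2 : ℕ) * ((s + 1) * (τ : ℤ_[2]))) := by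
    rw [map_sum]
    refine Finset.sum_congr rfl fun τ _ => ?_
    have e5 : xi τ ^ s * (1 + 2 * (s + 2 : ℕ) * xi τ) = xi τ ^ s + ((2 * (s + 2) : ℕ) : PowerSeries ℤ_[2]) * xi τ ^ (s + 1) := by
      push_cast; ring
    rw [e5, map_add, cz, (coeff_xi τ s).1, (coeff_xi τ s).2]
    push_cast; ring
  obtain ⟨c, hc⟩ : ∃ c : ℕ, (s + 2) * (s + 1) = 2 * c := by
    have : Even ((s + 1) * (s + 1 + 1)) := Nat.even_mul_succ_self _
    obtain ⟨c, hc⟩ := this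
    exact ⟨c, by linarith⟩
  obtain ⟨o', ho'⟩ : ∃ o', o = 2 * o' + 1 := ⟨o / 2, by omega⟩
  have hN : (∑ τ ∈ range (2 ^ m), (τ : ℤ_[2])) * 2 = 2 ^ m * (2 ^ m - 1) := by
    have := Finset.sum_range_id_mul_two (2 ^ m)
    have h2 := congrArg (Nat.cast : ℕ → ℤ_[2]) this
    push_cast [Nat.one_le_two_pow] at h2
    exact h2
  have hc' : ((s + 2) * (s + 1) : ℤ_[2]) = 2 * c := by exact_mod_cast congrArg (Nat.cast : ℕ → ℤ_[2]) hc
  have esum : ∑ τ ∈ range (2 ^ m), (1 + 2 * (s + 2 : ℕ) * ((s + 1) * (τ : ℤ_[2]))) = 2 ^ m * (1 + 2 * (c * (2 ^ m - 1))) := by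
    rw [Finset.sum_add_distrib]
    have : ∀ τ ∈ range (2 ^ m), (2 * (s + 2 : ℕ) * ((s + 1) * (τ : ℤ_[2]))) = (4 * c) * (τ : ℤ_[2]) := by
      intro τ _
      push_cast
      linear_combination 2 * (τ : ℤ_[2]) * hc'
    rw [Finset.sum_congr rfl this, ← Finset.mul_sum]
    simp only [Finset.sum_const, Finset.card_range, nsmul_eq_mul, mul_one]
    push_cast
    linear_combination 2 * (c : ℤ_[2]) * hN
  refine ⟨o * (1 + 2 * (c * (2 ^ m - 1))) + 2 * coeff s (∑ b ∈ range (2 ^ r), G b), ?_, ?_⟩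
  · rw [ho']
    have := unit_one_add_two ((o':ℤ_[2]) + (2 * o' + 1 : ℕ) * (c * (2 ^ m - 1)) + coeff s (∑ b ∈ range (2 ^ r), G b))
    convert this using 1
    push_cast
    ring
  · rw [e4]
    have e6 : (2 : PowerSeries ℤ_[2]) ^ (r * s + (s + 2) * Vf n) = ((2 ^ (r * s + (s + 2) * Vf n) : ℕ) : PowerSeries ℤ_[2]) := by push_cast; rfl
    have e7 : (2 : PowerSeries ℤ_[2]) * 2 ^ m = ((2 * 2 ^ m : ℕ) : PowerSeries ℤ_[2]) := by push_cast; rfl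
    rw [e6, e7, cz, map_add, cz, cz, ctau, esum]
    push_cast
    ring

end PartN2
end Z2

namespace Z2
section PartN3
open PowerSeries

lemma Vf_val {r n : ℕ} (hn : n + 1 = 2 ^ r) : Vf n + r = n := by
  have h1 : ∀ r : ℕ, padicValNat 2 (2 ^ r).factorial + 1 = 2 ^ r := by
    intro r
    induction r with
    | zero => simp
    | succ r ih => rw [pow_succ, mul_comm, padicValNat_factorial_mul]; omega
  have h2 := h1 r
  rw [← hn, ← Vf_eq, Vf, Finset.sum_range_succ, ← Vf, show padicValNat 2 (n + 1) = r by rw [hn, padicValNat.prime_pow]] at h2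
  omega

lemma RQ_Qg (s n r t : ℕ) :
    rescale ((2:ℚ_[2]) ^ r) (map (algebraMap ℚ ℚ_[2]) (RQ s n t)) =
      4 ^ (s + (2 * n + 1) * (s + 2)) * map (PadicInt.Coe.ringHom (p := 2)) (Qg s n ((t : PowerSeries ℤ_[2]) + 2 ^ r * X)) := by
  set f : PowerSeries ℚ →+* PowerSeries ℚ_[2] := (rescale ((2:ℚ_[2]) ^ r)).comp (map (algebraMap ℚ ℚ_[2])) with hf
  set g : PowerSeries ℤ_[2] →+* PowerSeries ℚ_[2] := map (PadicInt.Coe.ringHom (p := 2)) with hg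
  set y : PowerSeries ℤ_[2] := (t : PowerSeries ℤ_[2]) + 2 ^ r * X with hy
  change f (RQ s n t) = _
  have hT : g y = (t : PowerSeries ℚ_[2]) + 2 ^ r * X := by
    rw [hy, map_add, map_natCast, map_mul, map_pow, map_ofNat, hg, map_X]
  clear_value y
  have hfC : ∀ q : ℚ, f (C q) = C (q : ℚ_[2]) := by
    intro q
    rw [hf, RingHom.comp_apply, map_C]
    ext m
    rw [coeff_rescale, coeff_C, coeff_C]
    split_ifs with h
    · subst h; simp
    · simp
  have hfX : f X = 2 ^ r * X := by
    rw [hf, RingHom.comp_apply, map_X, rescale_X, map_pow]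
    rfl
  have c4 : (4 * C (1/4 : ℚ_[2]) : PowerSeries ℚ_[2]) = 1 := by
    have : (C (4:ℚ_[2]) : PowerSeries ℚ_[2]) = 4 := by rfl
    rw [← this, ← map_mul]; norm_num
  have hxx : f (xx t) = g y + C (1/4) := by
    rw [hT]
    unfold xx
    rw [map_add, hfC, hfX]
    push_cast
    rw [map_add]
    simp only [map_natCast]
    ring
  have h1 : f (4 * xx t - 1) = 4 * g y := by
    rw [map_sub, map_mul, hxx, map_one, map_ofNat]
    linear_combination c4
  have h2 : ∀ j : ℕ, f (4 * xx t + C (4 * (j:ℚ) + 3)) = 4 * g (y + ((j + 1 : ℕ) : PowerSeries ℤ_[2])) := by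
    intro j
    rw [map_add, map_mul, hxx, hfC, map_ofNat, map_add g y, map_natCast]
    push_cast
    rw [map_add, map_mul, map_natCast]
    have e4 : (C (4:ℚ_[2]) : PowerSeries ℚ_[2]) = 4 := by rfl
    have e3 : (C (3:ℚ_[2]) : PowerSeries ℚ_[2]) = 3 := by rfl
    rw [e4, e3]
    linear_combination c4
  have h3 : ∀ k : ℕ, f (uu k t) = 4 * g (Ring.inverse (1 + 4 * (y + (k : PowerSeries ℤ_[2])))) := by
    intro k
    have a1 := congrArg f (xx_mul_uu k t)
    rw [map_mul, map_add, hxx, hfC, map_one] at a1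
    have a2 := congrArg g (Ring.mul_inverse_cancel _ (unit_PS (y + (k : PowerSeries ℤ_[2]))))
    rw [map_mul, map_one, map_add, map_mul, map_add, map_one, map_ofNat, map_natCast] at a2
    push_cast at a1
    rw [map_natCast] at a1
    set I := g (Ring.inverse (1 + 4 * (y + (k : PowerSeries ℤ_[2]))))
    linear_combination (-f (uu k t)) * a2 + 4 * I * a1 - f (uu k t) * I * c4
  unfold RQ Qg
  rw [map_mul, map_pow, map_pow, map_mul, map_prod, map_prod, h1]
  simp_rw [h2, h3]
  rw [Finset.prod_mul_distrib, Finset.prod_mul_distrib]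
  simp only [Finset.prod_const, Finset.card_range]
  rw [map_mul, map_pow, map_pow, map_mul, map_prod, map_prod]
  have : (2 * n + 1) * (s + 2) = n * (s + 2) + (n + 1) * (s + 2) := by ring
  have e : (4:PowerSeries ℚ_[2]) ^ (s + (2 * n + 1) * (s + 2)) = 4 ^ s * ((4 ^ n) ^ (s + 2) * (4 ^ (n + 1)) ^ (s + 2)) := by
    rw [this, pow_add 4 s, pow_add 4 (n * (s + 2)), pow_mul 4 n, pow_mul 4 (n + 1)]
  rw [e]
  generalize (4:PowerSeries ℚ_[2]) ^ (n + 1) = p1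
  generalize (4:PowerSeries ℚ_[2]) ^ n = p2
  rw [mul_pow, mul_pow, mul_pow, mul_pow, mul_pow]
  ring

lemma RQ_coeff_Q (s n r t : ℕ) : (2:ℚ_[2]) ^ (r * s) * ((coeff s (RQ s n t) : ℚ) : ℚ_[2]) =
    4 ^ (s + (2 * n + 1) * (s + 2)) * ((coeff s (Qg s n ((t : PowerSeries ℤ_[2]) + 2 ^ r * X)) : ℤ_[2]) : ℚ_[2]) := by
  have h := congrArg (coeff s) (RQ_Qg s n r t)
  have e : (4 : PowerSeries ℚ_[2]) ^ (s + (2 * n + 1) * (s + 2)) = C (4 ^ (s + (2 * n + 1) * (s + 2)) : ℚ_[2]) := by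
    rw [map_pow]; rfl
  rw [coeff_rescale, coeff_map, e, coeff_C_mul, coeff_map, ← pow_mul] at h
  exact h

theorem LL_norm {r n s : ℕ} (hn : n + 1 = 2 ^ r) (hr : 1 ≤ r) (L : ℚ_[2])
    (hL : Tendsto (SM (fun t => coeff s (RQ s n t))) atTop (nhds L)) :
    ‖(2:ℚ_[2]) ^ r * L‖ = ‖(2:ℚ_[2]) ^ (2 * (s + (2 * n + 1) * (s + 2)) + (s + 2) * Vf n)‖ := by
  have key : ∀ m, ‖(2:ℚ_[2]) ^ r * SM (fun t => coeff s (RQ s n t)) (r + m)‖ =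
      ‖(2:ℚ_[2]) ^ (2 * (s + (2 * n + 1) * (s + 2)) + (s + 2) * Vf n)‖ := by
    intro m
    obtain ⟨u, hu, h⟩ := Qsum (s := s) hn hr m
    have h2 : ∑ t ∈ range (2 ^ (r + m)), PadicInt.Coe.ringHom (p := 2) (coeff s (Qg s n ((t : PowerSeries ℤ_[2]) + 2 ^ r * X))) =
        2 ^ (r * s + (s + 2) * Vf n) * 2 ^ m * PadicInt.Coe.ringHom (p := 2) u := by
      rw [← map_sum, h, map_mul, map_mul, map_pow, map_pow, map_ofNat]
    have h3 : (2:ℚ_[2]) ^ (r * s) * ∑ t ∈ range (2 ^ (r + m)), ((coeff s (RQ s n t) : ℚ) : ℚ_[2]) =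
        4 ^ (s + (2 * n + 1) * (s + 2)) * (2 ^ (r * s + (s + 2) * Vf n) * 2 ^ m * PadicInt.Coe.ringHom (p := 2) u) := by
      rw [← h2, Finset.mul_sum, Finset.mul_sum]
      exact Finset.sum_congr rfl fun t _ => RQ_coeff_Q s n r t
    have h4 : (2:ℚ_[2]) ^ r * SM (fun t => coeff s (RQ s n t)) (r + m) =
        2 ^ (2 * (s + (2 * n + 1) * (s + 2)) + (s + 2) * Vf n) * (u : ℚ_[2]) := by
      have e1 : (2:ℚ_[2]) ^ (r * s) ≠ 0 := pow_ne_zero _ two_ne_zero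
      have e2 : (2:ℚ_[2]) ^ (r + m) ≠ 0 := pow_ne_zero _ two_ne_zero
      have e3 : SM (fun t => coeff s (RQ s n t)) (r + m) * 2 ^ (r + m) = ∑ t ∈ range (2 ^ (r + m)), ((coeff s (RQ s n t) : ℚ) : ℚ_[2]) := by
        unfold SM
        field_simp
      rw [← e3] at h3
      apply mul_left_cancel₀ e1
      have e4 : (2:ℚ_[2]) ^ m ≠ 0 := pow_ne_zero _ two_ne_zero
      apply mul_right_cancel₀ e4
      rw [show (4:ℚ_[2]) = 2 ^ 2 by norm_num, ← pow_mul] at h3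
      rw [pow_add 2 r m] at h3
      rw [pow_add 2 (r * s) ((s + 2) * Vf n)] at h3
      rw [pow_add 2 _ ((s + 2) * Vf n)]
      have e5 : PadicInt.Coe.ringHom (p := 2) u = (u : ℚ_[2]) := rfl
      rw [e5] at h3
      linear_combination h3
    rw [h4, norm_mul]
    have : ‖(u : ℚ_[2])‖ = 1 := PadicInt.isUnit_iff.1 hu
    rw [this, mul_one]
  have h5 : Tendsto (fun m => ‖(2:ℚ_[2]) ^ r * SM (fun t => coeff s (RQ s n t)) (r + m)‖) atTop (nhds ‖(2:ℚ_[2]) ^ r * L‖) := by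
    have : Tendsto (fun m : ℕ => r + m) atTop atTop := tendsto_atTop_mono (fun m => Nat.le_add_left m r) tendsto_id
    exact ((hL.comp this).const_mul _).norm
  simp_rw [key] at h5
  exact tendsto_nhds_unique h5 tendsto_const_nhds

end PartN3
end Z2

namespace Z2
section PartZ

lemma Dv.shift {A : Type*} [CommRing A] {f : ℕ → A} (hf : Dv f) (h : ℕ) : Dv (fun t => f (t + h)) := fun x y => by
  have := hf (x + h) (y + h)
  convert this using 1
  push_cast; ring

/-- functions whose difference quotients are again nice -/
def C1 {A : Type*} [CommRing A] (f : ℕ → A) : Prop :=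
  Dv f ∧ ∀ h : ℕ, ∃ c : ℕ → A, Dv c ∧ ∀ k, f (k + h) - f k = h * c k

lemma C1.mul {A : Type*} [CommRing A] {f g : ℕ → A} (hf : C1 f) (hg : C1 g) : C1 (fun t => f t * g t) := by
  refine ⟨hf.1.mul hg.1, fun h => ?_⟩
  obtain ⟨c, hc, h1⟩ := hf.2 h
  obtain ⟨d, hd, h2⟩ := hg.2 h
  refine ⟨fun k => c k * g (k + h) + f k * d k, (hc.mul (hg.1.shift h)).add (hf.1.mul hd), fun k => ?_⟩
  linear_combination (g (k + h)) * h1 k + f k * h2 k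

lemma C1.pow {A : Type*} [CommRing A] {f : ℕ → A} (hf : C1 f) (m : ℕ) : C1 (fun t => f t ^ m) := by
  induction m with
  | zero => 
    refine ⟨by simpa using Dv.const (1:A), fun h => ⟨fun _ => 0, Dv.const 0, fun k => by simp⟩⟩
  | succ m ih => simp_rw [pow_succ]; exact ih.mul hf

lemma C1_inv : C1 (fun t : ℕ => Ring.inverse (1 + 4 * (t : ℤ_[2]))) := by
  have h0 : Dv (fun t : ℕ => (t : ℤ_[2])) := fun x y => dvd_rfl
  have h1 : Dv (fun t : ℕ => Ring.inverse (1 + 4 * (t : ℤ_[2]))) := iv_Dv unit_one_add_four h0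
  refine ⟨h1, fun h => ⟨fun k => -4 * (Ring.inverse (1 + 4 * (k : ℤ_[2])) * Ring.inverse (1 + 4 * ((k + h : ℕ) : ℤ_[2]))),
    (h1.mul (h1.shift h)).cmul _, fun k => ?_⟩⟩
  have a1 := Ring.mul_inverse_cancel _ (unit_one_add_four (k : ℤ_[2]))
  have a2 := Ring.mul_inverse_cancel _ (unit_one_add_four ((k + h : ℕ) : ℤ_[2]))
  dsimp only
  set I := Ring.inverse (1 + 4 * (k : ℤ_[2]))
  set J := Ring.inverse (1 + 4 * ((k + h : ℕ) : ℤ_[2]))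
  push_cast at a2
  linear_combination (-J) * a1 + I * a2

lemma exists_lim_C1 {f : ℕ → ℤ_[2]} (hf : C1 f) :
    ∃ Z : ℚ_[2], Tendsto (fun M : ℕ => (2 ^ M : ℚ_[2])⁻¹ * ∑ t ∈ range (2 ^ M), ((f t : ℤ_[2]) : ℚ_[2])) atTop (nhds Z) := by
  set S := fun M : ℕ => (2 ^ M : ℚ_[2])⁻¹ * ∑ t ∈ range (2 ^ M), ((f t : ℤ_[2]) : ℚ_[2]) with hS
  have key : ∀ M, ∃ g : ℤ_[2], S (M + 1) - S M = (1 / 4) * 2 ^ M * (g : ℚ_[2]) := by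
    intro M
    obtain ⟨c, hc, h⟩ := hf.2 (2 ^ M)
    obtain ⟨g, hg⟩ := hc.sum_dvd M
    refine ⟨g, ?_⟩
    have e1 : ∑ t ∈ range (2 ^ (M + 1)), f t = 2 * ∑ t ∈ range (2 ^ M), f t + 2 ^ M * ∑ t ∈ range (2 ^ M), c t := by
      rw [show 2 ^ (M + 1) = 2 ^ M + 2 ^ M by ring, Finset.sum_range_add, two_mul, add_assoc, Finset.mul_sum,
        ← Finset.sum_add_distrib, ← Finset.sum_add_distrib, ← Finset.sum_add_distrib]
      refine Finset.sum_congr rfl fun k _ => ?_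
      have := h k
      push_cast at this
      rw [add_comm (2 ^ M) k]
      linear_combination this
    have e2 : 2 * ∑ t ∈ range (2 ^ (M + 1)), f t = 4 * ∑ t ∈ range (2 ^ M), f t + 2 ^ M * (2 ^ M * g) := by
      rw [e1, ← hg]; ring
    have e3 := congrArg (PadicInt.Coe.ringHom (p := 2)) e2
    simp only [map_mul, map_add, map_pow, map_ofNat, map_sum] at e3
    have e4 : ∀ z : ℤ_[2], PadicInt.Coe.ringHom (p := 2) z = (z : ℚ_[2]) := fun z => rfl
    simp only [e4] at e3
    simp only [hS]
    have e5 : (2:ℚ_[2]) ^ M ≠ 0 := pow_ne_zero _ two_ne_zero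
    rw [pow_succ (2:ℚ_[2]), mul_inv]
    field_simp
    linear_combination 2 * e3
  have hcs : CauchySeq S := by
    refine cauchySeq_of_le_geometric (1 / 2) ‖(1 / 4 : ℚ_[2])‖ (by norm_num) fun M => ?_
    obtain ⟨g, hg⟩ := key M
    rw [dist_comm, dist_eq_norm, hg, norm_mul, norm_mul, norm_pow]
    have h2 : ‖(2:ℚ_[2])‖ = 1 / 2 := by
      have := Padic.norm_p (p := 2)
      simpa using this
    rw [h2]
    have h3 : ‖(g : ℚ_[2])‖ ≤ 1 := g.2
    have h4 : 0 ≤ ‖(1 / 4 : ℚ_[2])‖ * (1 / 2) ^ M := by positivity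
    nlinarith
  exact cauchySeq_tendsto_of_complete hcs

theorem exists_lim (m : ℕ) : ∃ Z : ℚ_[2], Tendsto (SM (fun t => (((t:ℚ) + 1 / 4)⁻¹) ^ m)) atTop (nhds Z) := by
  obtain ⟨Z, hZ⟩ := exists_lim_C1 (C1_inv.pow m)
  refine ⟨4 ^ m * Z, ?_⟩
  refine (hZ.const_mul (4 ^ m)).congr fun M => ?_
  unfold SM
  rw [mul_left_comm, Finset.mul_sum]
  congr 1
  refine Finset.sum_congr rfl fun t _ => ?_
  have a1 := congrArg (PadicInt.Coe.ringHom (p := 2)) (Ring.mul_inverse_cancel _ (unit_one_add_four (t : ℤ_[2])))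
  simp only [map_mul, map_add, map_one, map_ofNat, map_natCast] at a1
  have e4 : PadicInt.Coe.ringHom (p := 2) (Ring.inverse (1 + 4 * (t : ℤ_[2])) ^ m) = ((Ring.inverse (1 + 4 * (t : ℤ_[2])) ^ m : ℤ_[2]) : ℚ_[2]) := rfl
  rw [← e4, map_pow, ← mul_pow]
  push_cast
  congr 1
  symm
  apply inv_eq_of_mul_eq_one_right
  linear_combination a1

end PartZ
end Z2

namespace Z2
section PartF

lemma growth (s C K : ℕ) : ∃ R : ℕ, ∀ r ≥ R, ∀ n, n + 1 = 2 ^ r → ∀ D : ℕ,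
    D ^ 2 ≤ 2 ^ (3 * 2 ^ r + 8 * 2 ^ (r / 2 + 2)) → C * (2 ^ r) ^ K * D ^ (2 * s + 3) < 2 ^ (3 * n * (s + 2)) := by
  set c := 2 * C + 6 * (s + 2) with hc
  set A := c + 6 * K + 32 * (2 * s + 3) with hA
  refine ⟨2 * A, fun r hr n hn D hD => ?_⟩
  have hh : A ≤ r / 2 := by omega
  have h1 : r / 2 < 2 ^ (r / 2) := Nat.lt_two_pow_self
  set x := 2 ^ (r / 2) with hx
  have h2 : x * x ≤ 2 ^ r := by
    rw [hx, ← pow_add]; exact Nat.pow_le_pow_right (by norm_num) (by omega)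
  have h3 : c + 2 * K * r + 32 * (2 * s + 3) * x < 3 * 2 ^ r := by
    have h4 : r ≤ 3 * x := by omega
    have h5 : 2 * K * r ≤ 6 * K * x := by nlinarith
    have h6 : c ≤ c * x := by nlinarith
    have h7 : A * x < x * x := by nlinarith
    nlinarith
  refine lt_of_pow_lt_pow_left₀ 2 (by positivity) ?_
  have hC : C < 2 ^ C := Nat.lt_two_pow_self
  calc (C * (2 ^ r) ^ K * D ^ (2 * s + 3)) ^ 2 = C ^ 2 * 2 ^ (2 * K * r) * (D ^ 2) ^ (2 * s + 3) := by
        rw [mul_pow, mul_pow, ← pow_mul, ← pow_mul, ← pow_mul, ← pow_mul]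
        congr 2
        · congr 1; ring
        · ring
    _ ≤ (2 ^ C) ^ 2 * 2 ^ (2 * K * r) * (2 ^ (3 * 2 ^ r + 8 * 2 ^ (r / 2 + 2))) ^ (2 * s + 3) := by gcongr
    _ = 2 ^ (2 * C + 2 * K * r + (3 * 2 ^ r + 32 * x) * (2 * s + 3)) := by
        rw [← pow_mul, ← pow_mul, ← pow_add, ← pow_add, pow_add 2 (r / 2) 2, ← hx]
        congr 1; ring
    _ < (2 ^ (3 * n * (s + 2))) ^ 2 := by
        rw [← pow_mul]
        apply Nat.pow_lt_pow_right (by norm_num)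
        rw [← hn] at h3 ⊢
        rw [hc] at h3
        nlinarith

lemma DD_bound (r n : ℕ) (hn : n + 1 = 2 ^ r) (h : (Nat.lcmUpto (2 ^ r)) ^ 2 < 8 ^ (2 ^ r)) (m : ℕ) :
    DD n m ^ 2 ≤ 2 ^ (3 * 2 ^ r + 8 * m) := by
  have h1 : Nat.lcmUpto n ∣ Nat.lcmUpto (2 ^ r) := by
    rw [Nat.lcmUpto, Finset.lcm_dvd_iff]
    intro k hk
    exact Finset.dvd_lcm (by rw [Finset.mem_Icc] at hk ⊢; omega)
  have h2 : Nat.lcmUpto n ≤ Nat.lcmUpto (2 ^ r) := Nat.le_of_dvd (Nat.lcmUpto_pos _) h1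
  have h3 := primorial_le_four_pow m
  unfold DD
  calc (Nat.lcmUpto n * primorial m ^ 2) ^ 2 ≤ (Nat.lcmUpto (2 ^ r) * (4 ^ m) ^ 2) ^ 2 := by gcongr
    _ = Nat.lcmUpto (2 ^ r) ^ 2 * 2 ^ (8 * m) := by
      rw [mul_pow, show (4:ℕ) = 2 ^ 2 by norm_num, ← pow_mul, ← pow_mul, ← pow_mul]; congr 2; ring
    _ ≤ 8 ^ (2 ^ r) * 2 ^ (8 * m) := by gcongr
    _ = _ := by rw [show (8:ℕ) = 2 ^ 3 by norm_num, ← pow_mul, ← pow_add]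

lemma common (q : ℕ → ℚ) (N : ℕ) : ∃ q0 Q : ℕ, q0 ≠ 0 ∧ ∀ i ≤ N, (q0 : ℚ) * q i ∈ ZQ ∧ |q i| ≤ Q := by
  refine ⟨∏ i ∈ range (N + 1), (q i).den, ⌈∑ i ∈ range (N + 1), |q i|⌉₊, ?_, fun i hi => ⟨?_, ?_⟩⟩
  · exact Finset.prod_ne_zero_iff.2 fun i _ => (q i).den_ne_zero
  · obtain ⟨k, hk⟩ : (q i).den ∣ ∏ i ∈ range (N + 1), (q i).den := Finset.dvd_prod_of_mem (fun i => (q i).den) (by simp; omega)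
    rw [hk, mem_ZQ]
    refine ⟨(q i).num * k, ?_⟩
    have := Rat.mul_den_eq_num (q i)
    push_cast
    linear_combination (k:ℚ) * this
  · refine le_trans ?_ (Nat.le_ceil _)
    exact Finset.single_le_sum (f := fun i => |q i|) (fun i _ => abs_nonneg _) (by simp; omega)

lemma KB_bound (s n r : ℕ) (hn : n + 1 = 2 ^ r) :
    KB s n ≤ 4 ^ (s + 2) * (2 ^ r) ^ (s + 2) * 2 ^ (2 * n * (s + 2)) * ((2 ^ r) ^ (s + 1) * (s + 4) ^ (s + 1)) := by
  have e : (4 ^ n) ^ (s + 2) = 2 ^ (2 * n * (s + 2)) := by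
    rw [pow_mul, pow_mul]; norm_num
  have h1 : 1 ≤ 2 ^ r := Nat.one_le_two_pow
  unfold KB
  rw [hn, mul_pow, mul_pow, e, ← mul_pow (2 ^ r) (s + 4)]
  generalize 2 ^ r = x at *
  refine Nat.mul_le_mul le_rfl (Nat.pow_le_pow_left ?_ _)
  nlinarith

lemma alg_id (s n r q0 c1 D : ℕ) :
    (2 ^ r * (q0 * ((2 ^ n) ^ (s + 2) * D ^ (2 * s + 3)) * (c1 * 2 ^ r * (4 ^ (s + 2) * (2 ^ r) ^ (s + 2) * 2 ^ (2 * n * (s + 2)) * ((2 ^ r) ^ (s + 1) * (s + 4) ^ (s + 1)))))) * (2 ^ r) ^ (s + 2)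
    = 2 ^ (3 * n * (s + 2)) * (q0 * c1 * 4 ^ (s + 2) * (s + 4) ^ (s + 1) * (2 ^ r) ^ (3 * s + 7) * D ^ (2 * s + 3)) := by
  rw [← pow_mul 2 n, show 3 * n * (s + 2) = n * (s + 2) + 2 * n * (s + 2) by ring, pow_add 2 (n * (s + 2))]
  generalize (2:ℕ) ^ r = x
  have e : x ^ (3 * s + 7) = x * x * x ^ (s + 2) * x ^ (s + 1) * x ^ (s + 2) := by ring
  rw [e]
  generalize D ^ (2 * s + 3) = y
  generalize (2:ℕ) ^ (n * (s + 2)) = y1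
  generalize (2:ℕ) ^ (2 * n * (s + 2)) = y2
  generalize (4:ℕ) ^ (s + 2) = y3
  generalize (s + 4) ^ (s + 1) = y4
  generalize x ^ (s + 2) = z1
  generalize x ^ (s + 1) = z2
  ring

set_option maxHeartbeats 1000000 in
theorem main_contra (s : ℕ) (q : ℕ → ℚ) (hq : ∀ m, s + 2 ≤ m → m ≤ 2 * s + 2 →
    Tendsto (SM (fun t => (((t:ℚ) + 1 / 4)⁻¹) ^ m)) atTop (nhds ((q m : ℚ) : ℚ_[2]))) : False := by
  obtain ⟨q0, Q, hq0, hqQ⟩ := common q (2 * s + 2)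
  set c1 : ℕ := 2 ^ (2 * s + 2) * Q + (s + 1) * (2 ^ (2 * s + 2) * 4 ^ (2 * s + 3)) with hc1
  set C : ℕ := q0 * c1 * 4 ^ (s + 2) * (s + 4) ^ (s + 1) with hC
  obtain ⟨R, hR⟩ := growth s C (3 * s + 7)
  obtain ⟨r, hr, hlcm⟩ := lcm_small (R + 1)
  obtain ⟨n, hn⟩ : ∃ n, n + 1 = 2 ^ r := ⟨2 ^ r - 1, Nat.sub_add_cancel Nat.one_le_two_pow⟩
  set m := 2 ^ (r / 2 + 2) with hm
  have hm2 : 4 * n + 1 ≤ m ^ 2 := by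
    have : 4 * 2 ^ r ≤ m ^ 2 := by
      rw [hm, ← pow_mul, show 4 * 2 ^ r = 2 ^ (r + 2) by ring]
      exact Nat.pow_le_pow_right (by norm_num) (by omega)
    omega
  have hgrow := hR r (by omega) n hn (DD n m) (DD_bound r n hn hlcm m)
  obtain ⟨a, haR, haZ, haB, ha0⟩ := RQ_rep s n (Nat.lcmUpto n) (Nat.lcmUpto_pos n).ne' (fun k h h0 => dvd_lcm' h h0)
  have hT := LL_tendsto s n a q haR ha0 hq
  have hYint := LL_int s n m hm2 a q q0 haR haZ (fun i _ h => (hqQ i h).1)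
  have habs := LL_abs s n a q (KB s n) Q haB (fun i _ h => (hqQ i h).2)
  have hnorm := LL_norm hn (by omega) _ hT
  set L := LL s n a q with hL
  obtain ⟨Y, hY⟩ := mem_ZQ.1 hYint
  set E := 2 * (s + (2 * n + 1) * (s + 2)) + (s + 2) * Vf n with hE
  have hdvd : (2:ℤ) ^ (n * (s + 2) + E) ∣ 2 ^ r * Y := by
    have h1 : ‖((2 ^ r * Y : ℤ) : ℚ_[2])‖ ≤ (2:ℝ) ^ (-((n * (s + 2) + E : ℕ) : ℤ)) := by
      have hY2 : ((Y : ℤ) : ℚ_[2]) = (q0 : ℚ_[2]) * ((2 ^ n) ^ (s + 2) * (DD n m : ℚ_[2]) ^ (2 * s + 3)) * ((L : ℚ) : ℚ_[2]) := by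
        have := congrArg (fun z : ℚ => (z : ℚ_[2])) hY
        push_cast at this
        rw [← this]
      have e1 : ((2 ^ r * Y : ℤ) : ℚ_[2]) = ((q0 * DD n m ^ (2 * s + 3) : ℕ) : ℤ) * (2 ^ (n * (s + 2)) * (2 ^ r * ((L : ℚ) : ℚ_[2]))) := by
        push_cast
        rw [hY2, ← pow_mul]; ring
      have e2 : ‖(2:ℚ_[2])‖ = 1 / 2 := by
        have := Padic.norm_p (p := 2)
        simpa using this
      rw [e1, norm_mul, norm_mul, hnorm, norm_pow, norm_pow, e2, ← pow_add]
      have e3 := Padic.norm_int_le_one (p := 2) ((q0 * DD n m ^ (2 * s + 3) : ℕ) : ℤ)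
      have e4 : (2:ℝ) ^ (-((n * (s + 2) + E : ℕ) : ℤ)) = (1 / 2) ^ (n * (s + 2) + E) := by
        rw [zpow_neg, zpow_natCast, one_div, inv_pow]
      rw [e4]
      have e5 : (0:ℝ) ≤ (1 / 2) ^ (n * (s + 2) + E) := by positivity
      nlinarith
    have h2 := (Padic.norm_int_le_pow_iff_dvd (p := 2) (2 ^ r * Y) (n * (s + 2) + E)).1 (by exact_mod_cast h1)
    exact_mod_cast h2
  have hL0 : L ≠ 0 := by
    intro h
    rw [h, Rat.cast_zero, mul_zero, norm_zero] at hnorm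
    exact (norm_ne_zero_iff.2 (pow_ne_zero _ (two_ne_zero : (2:ℚ_[2]) ≠ 0))) hnorm.symm
  have hD0 : (DD n m : ℚ) ≠ 0 := by exact_mod_cast DD_ne n m
  have hY0 : Y ≠ 0 := by
    rintro rfl
    have : (q0 : ℚ) * ((2 ^ n) ^ (s + 2) * (DD n m : ℚ) ^ (2 * s + 3)) * L ≠ 0 := by
      have : (q0 : ℚ) ≠ 0 := by exact_mod_cast hq0
      positivity
    exact this (by simpa using hY)
  have hlow : (2:ℤ) ^ (n * (s + 2) + E) ≤ 2 ^ r * |Y| := by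
    have := Int.le_of_dvd (by positivity) ((dvd_abs _ _).2 hdvd)
    rwa [abs_mul, abs_of_pos (by positivity : (0:ℤ) < 2 ^ r)] at this
  have hlowQ : (2:ℚ) ^ (n * (s + 2) + E) ≤ 2 ^ r * |(Y:ℚ)| := by exact_mod_cast hlow
  have hV := Vf_val hn
  have hup : |(Y:ℚ)| ≤ (q0 * ((2 ^ n) ^ (s + 2) * DD n m ^ (2 * s + 3)) * (c1 * 2 ^ r * KB s n) : ℕ) := by
    rw [← hY, abs_mul, abs_of_nonneg (by positivity : (0:ℚ) ≤ (q0 : ℚ) * ((2 ^ n) ^ (s + 2) * (DD n m : ℚ) ^ (2 * s + 3)))]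
    push_cast
    gcongr
    refine habs.trans ?_
    gcongr
    have : (1:ℚ) ≤ 2 ^ r := one_le_pow₀ (by norm_num)
    have hnq : (n:ℚ) ≤ 2 ^ r := by
      have : (n:ℚ) + 1 = 2 ^ r := by exact_mod_cast hn
      linarith
    rw [hc1]; push_cast
    have p1 : (0:ℚ) ≤ 2 ^ (2 * s + 2) * Q := by positivity
    have p2 : (0:ℚ) ≤ (s + 1) * (2 ^ (2 * s + 2) * 4 ^ (2 * s + 3)) := by positivity
    nlinarith
  have hfin : (2:ℕ) ^ (n * (s + 2) + E) ≤ 2 ^ r * (q0 * ((2 ^ n) ^ (s + 2) * DD n m ^ (2 * s + 3)) * (c1 * 2 ^ r * KB s n)) := by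
    have : (2:ℚ) ^ (n * (s + 2) + E) ≤ 2 ^ r * ((q0 * ((2 ^ n) ^ (s + 2) * DD n m ^ (2 * s + 3)) * (c1 * 2 ^ r * KB s n) : ℕ) : ℚ) :=
      hlowQ.trans (by gcongr)
    exact_mod_cast this
  have hKB := KB_bound s n r hn
  have hbig : 2 ^ (3 * n * (s + 2)) * 2 ^ (3 * n * (s + 2)) ≤ 2 ^ (3 * n * (s + 2)) * (C * (2 ^ r) ^ (3 * s + 7) * DD n m ^ (2 * s + 3)) := by
    calc 2 ^ (3 * n * (s + 2)) * 2 ^ (3 * n * (s + 2)) ≤ 2 ^ (n * (s + 2) + E) * (2 ^ r) ^ (s + 2) := by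
          rw [← pow_add, ← pow_mul, ← pow_add]
          apply Nat.pow_le_pow_right (by norm_num)
          rw [hE]
          nlinarith
      _ ≤ (2 ^ r * (q0 * ((2 ^ n) ^ (s + 2) * DD n m ^ (2 * s + 3)) * (c1 * 2 ^ r * (4 ^ (s + 2) * (2 ^ r) ^ (s + 2) * 2 ^ (2 * n * (s + 2)) * ((2 ^ r) ^ (s + 1) * (s + 4) ^ (s + 1)))))) * (2 ^ r) ^ (s + 2) := by
          refine Nat.mul_le_mul_right _ (hfin.trans ?_)
          gcongr
      _ = _ := by
          rw [hC]; exact alg_id _ _ _ _ _ _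
  have := Nat.le_of_mul_le_mul_left hbig (by positivity)
  omega

end PartF
end Z2

theorem irrational_zeta2Quarter_in_short_range (s : ℕ) :
    ∃ j : ℕ, s + 3 ≤ j ∧ j ≤ 2 * s + 3 ∧
      ∃ z : ℚ_[2], zeta2Quarter j z ∧ ∀ q : ℚ, z ≠ (q : ℚ_[2]) := by
  by_contra hcon
  push Not at hcon
  have h : ∀ m : ℕ, ∃ q : ℚ, s + 2 ≤ m → m ≤ 2 * s + 2 →
      Tendsto (Z2.SM (fun t => (((t:ℚ) + 1 / 4)⁻¹) ^ m)) atTop (nhds ((q : ℚ) : ℚ_[2])) := by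
    intro m
    by_cases hm : s + 2 ≤ m ∧ m ≤ 2 * s + 2
    · obtain ⟨Z, hZ⟩ := Z2.exists_lim m
      have hm0 : (m : ℚ_[2]) ≠ 0 := by
        have : m ≠ 0 := by omega
        exact_mod_cast this
      have h4 : (4:ℚ_[2]) ^ m ≠ 0 := pow_ne_zero _ (by norm_num)
      have e : (((m + 1 : ℕ) : ℚ_[2]) - 1) * 4 ^ (m + 1 - 1) * (Z / (m * 4 ^ m)) = Z := by
        rw [Nat.add_sub_cancel]
        push_cast
        rw [add_sub_cancel_right]
        field_simp
      obtain ⟨q, hq⟩ := hcon (m + 1) (by omega) (by omega) (Z / (m * 4 ^ m)) (by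
        unfold zeta2Quarter
        rw [e]
        refine hZ.congr fun M => ?_
        unfold Z2.SM
        congr 1
        refine Finset.sum_congr rfl fun k _ => ?_
        congr 1
        rw [show (1 : ℤ) - ((m + 1 : ℕ) : ℤ) = -(m : ℤ) by push_cast; ring, zpow_neg, zpow_natCast, ← inv_pow])
      refine ⟨m * 4 ^ m * q, fun _ _ => ?_⟩
      have : Z = ((m * 4 ^ m * q : ℚ) : ℚ_[2]) := by
        push_cast
        rw [← hq]
        field_simp
      rw [← this]
      exact hZ
    · exact ⟨0, fun h1 h2 => absurd ⟨h1, h2⟩ hm⟩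
  choose q hq using h
  exact Z2.main_contra s q hq
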